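/- arXiv:1708.06631 — 2 statements merged into one kernel-verified Lean document; each statement's English description precedes it below -/
import Mathlib

section
/- Let X be a real Hilbert space, C ⊂ X a nonempty closed convex set, x̄ ∈ C and v̂ ∈ N_C(x̄). Then: (i) ℋ^w(x̄,v̂) ⊂ cl[T_C(x̄) − T_C(x̄)] ∩ {v̂}^⊥; (ii) if C is polyhedric, then 𝒦_C(x̄,v̂) − 𝒦_C(x̄,v̂) ⊂ ℋ^s(x̄,v̂); (iii) if X is finite-dimensional and C is a convex polyhedron, then ℋ^s(x̄,v̂) = ℋ^w(x̄,v̂) = 𝒦_C(x̄,v̂) − 𝒦_C(x̄,v̂). -/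
noncomputable section

open Filter Topology Metric Set MeasureTheory
open scoped RealInnerProductSpace Pointwise

namespace PVS

variable {X : Type*} [NormedAddCommGroup X] [InnerProductSpace ℝ X]
variable {Y : Type*} [NormedAddCommGroup Y] [InnerProductSpace ℝ Y]
variable {W : Type*} [NormedAddCommGroup W] [InnerProductSpace ℝ W]
variable {P : Type*} [MetricSpace P]
variable {Q : Type*} [MetricSpace Q]

/-- Regular (Fréchet) subdifferential of an extended-real-valued function. -/
def regSubdiff (h : X → EReal) (x : X) : Set X :=
  {v | h x ≠ ⊤ ∧ h x ≠ ⊥ ∧ ∀ ε > (0:ℝ), ∀ᶠ u in 𝓝 x,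
      h x + ((⟪v, u - x⟫ - ε * ‖u - x‖ : ℝ) : EReal) ≤ h u}

/-- Weak sequential convergence in an inner product space. -/
def WeakTendsto (xs : ℕ → X) (x : X) : Prop :=
  ∀ z : X, Tendsto (fun k => ⟪xs k, z⟫) atTop (𝓝 ⟪x, z⟫)

/-- Limiting (Mordukhovich) subdifferential. -/
def limSubdiff (h : X → EReal) (x : X) : Set X :=
  {v | ∃ xs vs : ℕ → X, Tendsto xs atTop (𝓝 x) ∧
      Tendsto (fun k => h (xs k)) atTop (𝓝 (h x)) ∧
      (∀ k, vs k ∈ regSubdiff h (xs k)) ∧ WeakTendsto vs v}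

/-- Partial limiting subdifferential with respect to the first variable. -/
def pSubdiff {PP : Type*} (g : X → PP → EReal) (x : X) (p : PP) : Set X :=
  limSubdiff (fun x' => g x' p) x

/-- Graph of a set-valued map. -/
def gph (F : X → Set Y) : Set (X × Y) := {t | t.2 ∈ F t.1}

/-- Regular normal cone. -/
def regNC (Ω : Set X) (x : X) : Set X :=
  {v | ∀ ε > (0:ℝ), ∀ᶠ y in 𝓝[Ω] x, ⟪v, y - x⟫ ≤ ε * ‖y - x‖}

/-- Limiting normal cone. -/
def limNC (Ω : Set X) (x : X) : Set X :=
  {v | ∃ xs vs : ℕ → X, (∀ k, xs k ∈ Ω) ∧ Tendsto xs atTop (𝓝 x) ∧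
      (∀ k, vs k ∈ regNC Ω (xs k)) ∧ Tendsto vs atTop (𝓝 v)}

/-- Regular normal cone to a subset of a product of two inner product spaces,
with the Euclidean product norm. -/
def regNC2 (Ω : Set (X × Y)) (ω : X × Y) : Set (X × Y) :=
  {ζ | ∀ ε > (0:ℝ), ∀ᶠ y in 𝓝[Ω] ω,
      ⟪ζ.1, y.1 - ω.1⟫ + ⟪ζ.2, y.2 - ω.2⟫
        ≤ ε * Real.sqrt (‖y.1 - ω.1‖ ^ 2 + ‖y.2 - ω.2‖ ^ 2)}

/-- Limiting normal cone in a product of two spaces. -/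
def limNC2 (Ω : Set (X × Y)) (ω : X × Y) : Set (X × Y) :=
  {ζ | ∃ ωs ζs : ℕ → X × Y, (∀ k, ωs k ∈ Ω) ∧ Tendsto ωs atTop (𝓝 ω) ∧
      (∀ k, ζs k ∈ regNC2 Ω (ωs k)) ∧ Tendsto ζs atTop (𝓝 ζ)}

/-- Regular coderivative of a set-valued map. -/
def regCoderiv (F : X → Set Y) (u : X) (v : Y) (w : Y) : Set X :=
  {z | (z, -w) ∈ regNC2 (gph F) (u, v)}

/-- Limiting coderivative of a set-valued map. -/
def limCoderiv (F : X → Set Y) (u : X) (v : Y) (w : Y) : Set X :=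
  {z | (z, -w) ∈ limNC2 (gph F) (u, v)}

/-- Regular normal cone in a product of three inner product spaces. -/
def regNC3 (Ω : Set (X × W × Y)) (ω : X × W × Y) : Set (X × W × Y) :=
  {ζ | ∀ ε > (0:ℝ), ∀ᶠ y in 𝓝[Ω] ω,
      ⟪ζ.1, y.1 - ω.1⟫ + ⟪ζ.2.1, y.2.1 - ω.2.1⟫ + ⟪ζ.2.2, y.2.2 - ω.2.2⟫
        ≤ ε * Real.sqrt (‖y.1 - ω.1‖ ^ 2 + ‖y.2.1 - ω.2.1‖ ^ 2 + ‖y.2.2 - ω.2.2‖ ^ 2)}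

/-- Limiting normal cone in a product of three inner product spaces. -/
def limNC3 (Ω : Set (X × W × Y)) (ω : X × W × Y) : Set (X × W × Y) :=
  {ζ | ∃ ωs ζs : ℕ → X × W × Y, (∀ k, ωs k ∈ Ω) ∧ Tendsto ωs atTop (𝓝 ω) ∧
      (∀ k, ζs k ∈ regNC3 Ω (ωs k)) ∧ Tendsto ζs atTop (𝓝 ζ)}

/-- Limiting coderivative of the full partial subdifferential map (x,p) ↦ ∂ₓ g(x,p). -/
def limCoderivFull (g : X → W → EReal) (xb : X) (pb : W) (vh : X) (w : X) : Set (X × W) :=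
  {zs | (zs.1, zs.2, -w) ∈ limNC3 {t : X × W × X | t.2.2 ∈ pSubdiff g t.1 t.2.1} (xb, pb, vh)}

/-- Lipschitz-like (Aubin) property of a set-valued map around a graph point. -/
def LipschitzLike {α Z : Type*} [MetricSpace α] [SeminormedAddCommGroup Z]
    (F : α → Set Z) (ab : α) (zb : Z) : Prop :=
  ∃ ℓ > (0:ℝ), ∃ U ∈ 𝓝 ab, ∃ V ∈ 𝓝 zb,
    ∀ a ∈ U, ∀ a' ∈ U, ∀ z ∈ F a ∩ V, ∃ z' ∈ F a', ‖z - z'‖ ≤ ℓ * dist a a'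

/-- Epigraph of g(·,p). -/
def epi {PP : Type*} (g : X → PP → EReal) (p : PP) : Set (X × ℝ) :=
  {q | g q.1 p ≤ (q.2 : EReal)}

/-- (A1): Lipschitz continuity of the base around the reference point. -/
def A1 (f : X → P → Q → X) (xb : X) (pb : P) (qb : Q) : Prop :=
  ∃ L > (0:ℝ), ∃ ε > (0:ℝ), ∀ x₁ x₂ p₁ p₂ q₁ q₂,
    ‖x₁ - xb‖ < ε → ‖x₂ - xb‖ < ε → dist p₁ pb < ε → dist p₂ pb < ε →
    dist q₁ qb < ε → dist q₂ qb < ε →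
    ‖f x₁ p₁ q₁ - f x₂ p₂ q₂‖ ≤ L * (‖x₁ - x₂‖ + dist p₁ p₂ + dist q₁ q₂)

/-- Parametric prox-regularity with prox-parameter r. -/
def ProxRegWith (g : X → P → EReal) (xb : X) (pb : P) (vh : X) (r : ℝ) : Prop :=
  ∃ ε > (0:ℝ), ∀ x u p v, ‖x - xb‖ < ε → ‖u - xb‖ < ε → dist p pb < ε → ‖v - vh‖ < ε →
    v ∈ pSubdiff g u p →
    g u p + ((⟪v, x - u⟫ - r / 2 * ‖x - u‖ ^ 2 : ℝ) : EReal) ≤ g x p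

/-- Subdifferential continuity with compatible parameterization. -/
def SubdiffCont (g : X → P → EReal) (xb : X) (pb : P) (vh : X) : Prop :=
  Tendsto (fun t : X × P × X => g t.1 t.2.1)
    (𝓝[{t : X × P × X | t.2.2 ∈ pSubdiff g t.1 t.2.1}] (xb, pb, vh)) (𝓝 (g xb pb))

/-- (A2): parametric continuous prox-regularity. -/
def A2 (g : X → P → EReal) (xb : X) (pb : P) (vh : X) : Prop :=
  (∃ r > (0:ℝ), ProxRegWith g xb pb vh r) ∧ SubdiffCont g xb pb vh

/-- Threshold of prox-regularity. -/
def proxThreshold (g : X → P → EReal) (xb : X) (pb : P) (vh : X) : ℝ :=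
  sInf {r : ℝ | 0 < r ∧ ProxRegWith g xb pb vh r}

/-- (A3): basic constraint qualification. -/
def A3 (g : X → P → EReal) (xb : X) (pb : P) : Prop :=
  LipschitzLike (fun p => epi g p) pb (xb, (g xb pb).toReal)

/-- (A4): uniform partial differentiability with partial Jacobian continuous at the point. -/
def A4 (f : X → P → Q → X) (Df : X → P → Q → X →L[ℝ] X) (xb : X) (pb : P) (qb : Q) : Prop :=
  (∃ η > (0:ℝ), ∀ ε > (0:ℝ), ∃ δ > (0:ℝ), ∀ x p q,
      ‖x - xb‖ < η → dist p pb < η → dist q qb < η →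
      ∀ x', ‖x' - x‖ < δ →
        ‖f x' p q - f x p q - Df x p q (x' - x)‖ ≤ ε * ‖x' - x‖) ∧
  Tendsto (fun t : X × P × Q => Df t.1 t.2.1 t.2.2) (𝓝 (xb, pb, qb)) (𝓝 (Df xb pb qb))

/-- Solution map of the parametric variational system. -/
def SolMap (f : X → P → Q → X) (g : X → P → EReal) (v : X) (p : P) (q : Q) : Set X :=
  {x | v - f x p q ∈ pSubdiff g x p}

/-- Single-valued localization of a three-parametric solution map. -/
def Localizes3 (S : X → P → Q → Set X) (V : Set X) (Pn : Set P) (Qn : Set Q) (U : Set X)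
    (ϑ : X → P → Q → X) : Prop :=
  ∀ v ∈ V, ∀ p ∈ Pn, ∀ q ∈ Qn,
    ϑ v p q ∈ U ∧ ϑ v p q ∈ S v p q ∧ ∀ x ∈ U, x ∈ S v p q → x = ϑ v p q

/-- Lipschitzian full stability. -/
def LipFullStable (S : X → P → Q → Set X) (xb vb : X) (pb : P) (qb : Q) : Prop :=
  ∃ V ∈ 𝓝 vb, ∃ Pn ∈ 𝓝 pb, ∃ Qn ∈ 𝓝 qb, ∃ U ∈ 𝓝 xb, ∃ ϑ : X → P → Q → X,
    Localizes3 S V Pn Qn U ϑ ∧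
    ∃ κ > (0:ℝ), ∃ ℓ > (0:ℝ), ∀ v₁ ∈ V, ∀ p₁ ∈ Pn, ∀ q₁ ∈ Qn, ∀ v₂ ∈ V, ∀ p₂ ∈ Pn, ∀ q₂ ∈ Qn,
      ‖(v₁ - v₂) - (2 * κ) • (ϑ v₁ p₁ q₁ - ϑ v₂ p₂ q₂)‖
        ≤ ‖v₁ - v₂‖ + ℓ * (dist p₁ p₂ + dist q₁ q₂)

/-- Hölderian full stability with given moduli. -/
def HolderFullStableWith (S : X → P → Q → Set X) (xb vb : X) (pb : P) (qb : Q) (κ ℓ : ℝ) : Prop :=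
  ∃ V ∈ 𝓝 vb, ∃ Pn ∈ 𝓝 pb, ∃ Qn ∈ 𝓝 qb, ∃ U ∈ 𝓝 xb, ∃ ϑ : X → P → Q → X,
    Localizes3 S V Pn Qn U ϑ ∧
    ∀ v₁ ∈ V, ∀ p₁ ∈ Pn, ∀ q₁ ∈ Qn, ∀ v₂ ∈ V, ∀ p₂ ∈ Pn, ∀ q₂ ∈ Qn,
      ‖(v₁ - v₂) - (2 * κ) • (ϑ v₁ p₁ q₁ - ϑ v₂ p₂ q₂)‖
        ≤ ‖v₁ - v₂‖ + ℓ * (Real.sqrt (dist p₁ p₂) + dist q₁ q₂)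

/-- Hölderian full stability. -/
def HolderFullStable (S : X → P → Q → Set X) (xb vb : X) (pb : P) (qb : Q) : Prop :=
  ∃ κ > (0:ℝ), ∃ ℓ > (0:ℝ), HolderFullStableWith S xb vb pb qb κ ℓ

/-- Neighborhood second-order condition via the regular coderivative of ∂g_p. -/
def SOC (g : X → P → EReal) (A : X →L[ℝ] X) (xb : X) (pb : P) (vh : X) (η κ₀ : ℝ) : Prop :=
  ∀ u p v, ‖u - xb‖ ≤ η → dist p pb ≤ η → ‖v - vh‖ ≤ η → v ∈ pSubdiff g u p →
    ∀ w z, z ∈ regCoderiv (fun y => pSubdiff g y p) u v w →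
      κ₀ * ‖w‖ ^ 2 ≤ ⟪A w, w⟫ + ⟪z, w⟫

/-- The graphical map p ↦ gph ∂ₓ g(·,p). -/
def gphMap (g : X → P → EReal) (p : P) : Set (X × X) := {t | t.2 ∈ pSubdiff g t.1 p}

/-- Local strong monotonicity of f in x with modulus σ. -/
def StrongMono (f : X → P → Q → X) (xb : X) (pb : P) (qb : Q) (σ : ℝ) : Prop :=
  ∃ ε > (0:ℝ), ∀ x₁ x₂ p q, ‖x₁ - xb‖ < ε → ‖x₂ - xb‖ < ε → dist p pb < ε → dist q qb < ε →
    σ * ‖x₁ - x₂‖ ^ 2 ≤ ⟪f x₁ p q - f x₂ p q, x₁ - x₂⟫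

/-- The proximal mapping P_λ(v,p) = {x : v ∈ x + λ ∂ₓ g(x,p)}. -/
def proxMap (g : X → P → EReal) (lam : ℝ) (v : X) (p : P) : Set X :=
  {x | ∃ s ∈ pSubdiff g x p, v = x + lam • s}

/-- Single-valued localization of a two-parametric solution map. -/
def Localizes2 (S : X → P → Set X) (V : Set X) (Pn : Set P) (U : Set X) (ϑ : X → P → X) : Prop :=
  ∀ v ∈ V, ∀ p ∈ Pn, ϑ v p ∈ U ∧ ϑ v p ∈ S v p ∧ ∀ x ∈ U, x ∈ S v p → x = ϑ v p

/-- (Lipschitzian) full stability of a two-parametric system. -/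
def FullStable2 (S : X → P → Set X) (xb vb : X) (pb : P) : Prop :=
  ∃ V ∈ 𝓝 vb, ∃ Pn ∈ 𝓝 pb, ∃ U ∈ 𝓝 xb, ∃ ϑ : X → P → X,
    Localizes2 S V Pn U ϑ ∧
    ∃ κ > (0:ℝ), ∃ ℓ > (0:ℝ), ∀ v₁ ∈ V, ∀ p₁ ∈ Pn, ∀ v₂ ∈ V, ∀ p₂ ∈ Pn,
      ‖(v₁ - v₂) - (2 * κ) • (ϑ v₁ p₁ - ϑ v₂ p₂)‖ ≤ ‖v₁ - v₂‖ + ℓ * dist p₁ p₂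

/-- Normal cone of convex analysis. -/
def convNC (C : Set X) (x : X) : Set X := {v | x ∈ C ∧ ∀ y ∈ C, ⟪v, y - x⟫ ≤ 0}

/-- Solution map of a parametric variational inequality. -/
def SolMapVI (f : X → P → X) (C : Set X) (v : X) (p : P) : Set X :=
  {x | v - f x p ∈ convNC C x}

/-- Radial cone. -/
def radialCone (C : Set X) (x : X) : Set X := {w | ∃ t > (0:ℝ), x + t • w ∈ C}

/-- Tangent cone (closure of the radial cone). -/
def tangentC (C : Set X) (x : X) : Set X := closure (radialCone C x)

/-- Critical cone. -/
def criticalCone (C : Set X) (x v : X) : Set X := tangentC C x ∩ {w | ⟪v, w⟫ = 0}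

/-- Polyhedricity of a closed convex set. -/
def Polyhedric (C : Set X) : Prop :=
  ∀ x ∈ C, ∀ v ∈ convNC C x,
    criticalCone C x v = closure (radialCone C x ∩ {w | ⟪v, w⟫ = 0})

/-- Weak sequential outer limit of critical cones. -/
def Hw (C : Set X) (xb vh : X) : Set X :=
  {w | ∃ xs vs ws : ℕ → X, (∀ k, vs k ∈ convNC C (xs k)) ∧
      Tendsto xs atTop (𝓝 xb) ∧ Tendsto vs atTop (𝓝 vh) ∧
      (∀ k, ws k ∈ criticalCone C (xs k) (vs k)) ∧ WeakTendsto ws w}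

/-- Strong sequential outer limit of critical cones. -/
def Hs (C : Set X) (xb vh : X) : Set X :=
  {w | ∃ xs vs ws : ℕ → X, (∀ k, vs k ∈ convNC C (xs k)) ∧
      Tendsto xs atTop (𝓝 xb) ∧ Tendsto vs atTop (𝓝 vh) ∧
      (∀ k, ws k ∈ criticalCone C (xs k) (vs k)) ∧ Tendsto ws atTop (𝓝 w)}

/-- Convex polyhedron: finite intersection of closed half-spaces. -/
def IsPolyhedron (C : Set X) : Prop :=
  ∃ (k : ℕ) (a : Fin k → X) (b : Fin k → ℝ), C = {x | ∀ i, ⟪a i, x⟫ ≤ b i}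

/-- Legendre form. -/
def LegendreForm (Qf : X → ℝ) : Prop :=
  (∃ A : X →L[ℝ] X, ∀ x, Qf x = ⟪A x, x⟫) ∧
  (∀ (xs : ℕ → X) (x : X), WeakTendsto xs x → Qf x ≤ liminf (fun k => Qf (xs k)) atTop) ∧
  (∀ (xs : ℕ → X) (x : X), WeakTendsto xs x →
     Tendsto (fun k => Qf (xs k)) atTop (𝓝 (Qf x)) → Tendsto xs atTop (𝓝 x))

/-- (A1) for a two-parametric base mapping. -/
def A1two (f : X → P → X) (xb : X) (pb : P) : Prop :=
  ∃ L > (0:ℝ), ∃ ε > (0:ℝ), ∀ x₁ x₂ p₁ p₂,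
    ‖x₁ - xb‖ < ε → ‖x₂ - xb‖ < ε → dist p₁ pb < ε → dist p₂ pb < ε →
    ‖f x₁ p₁ - f x₂ p₂‖ ≤ L * (‖x₁ - x₂‖ + dist p₁ p₂)

/-- (A4) for a two-parametric base mapping. -/
def A4two (f : X → P → X) (Df : X → P → X →L[ℝ] X) (xb : X) (pb : P) : Prop :=
  (∃ η > (0:ℝ), ∀ ε > (0:ℝ), ∃ δ > (0:ℝ), ∀ x p,
      ‖x - xb‖ < η → dist p pb < η →
      ∀ x', ‖x' - x‖ < δ → ‖f x' p - f x p - Df x p (x' - x)‖ ≤ ε * ‖x' - x‖) ∧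
  Tendsto (fun t : X × P => Df t.1 t.2) (𝓝 (xb, pb)) (𝓝 (Df xb pb))

/-- Euclidean distance in X × ℝ. -/
def pairDist (a b : X × ℝ) : ℝ := Real.sqrt (‖a.1 - b.1‖ ^ 2 + |a.2 - b.2| ^ 2)

/-- Pompeiu–Hausdorff distance between subsets of X × ℝ (Euclidean product norm). -/
def hausPH (C₁ C₂ : Set (X × ℝ)) : ℝ :=
  sInf {η : ℝ | 0 ≤ η ∧ (∀ a ∈ C₁, ∃ b ∈ C₂, pairDist a b ≤ η) ∧
                 ∀ b ∈ C₂, ∃ a ∈ C₁, pairDist a b ≤ η}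

/-- Nonparametric prox-regularity with parameter r. -/
def ProxRegWithNP (g : X → EReal) (xb vh : X) (r : ℝ) : Prop :=
  ∃ ε > (0:ℝ), ∀ x u v, ‖x - xb‖ < ε → ‖u - xb‖ < ε → ‖v - vh‖ < ε →
    v ∈ limSubdiff g u → g u ≤ g xb + (ε : EReal) →
    g u + ((⟪v, x - u⟫ - r / 2 * ‖x - u‖ ^ 2 : ℝ) : EReal) ≤ g x

/-- Nonparametric subdifferential continuity. -/
def SubdiffContNP (g : X → EReal) (xb vh : X) : Prop :=
  Tendsto (fun t : X × X => g t.1) (𝓝[gph (limSubdiff g)] (xb, vh)) (𝓝 (g xb))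

/-- Nonparametric threshold of prox-regularity. -/
def proxThresholdNP (g : X → EReal) (xb vh : X) : ℝ :=
  sInf {r : ℝ | 0 < r ∧ ProxRegWithNP g xb vh r}


section Auxiliary

lemma zero_mem_radialCone {C : Set X} {x : X} (hx : x ∈ C) : (0 : X) ∈ radialCone C x :=
  ⟨1, one_pos, by simpa using hx⟩

lemma sub_mem_radialCone {C : Set X} {x y : X} (hy : y ∈ C) : y - x ∈ radialCone C x :=
  ⟨1, one_pos, by simpa using hy⟩

lemma smul_mem_radialCone {C : Set X} {x w : X} (hw : w ∈ radialCone C x) {c : ℝ} (hc : 0 < c) :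
    c • w ∈ radialCone C x := by
  obtain ⟨t, ht, h⟩ := hw
  refine ⟨t / c, by positivity, ?_⟩
  rwa [smul_smul, div_mul_cancel₀ _ hc.ne']

lemma add_smul_mem_of_le {C : Set X} (hC : Convex ℝ C) {x w : X} (hx : x ∈ C) {s t : ℝ}
    (hs : 0 ≤ s) (hst : s ≤ t) (h : x + t • w ∈ C) : x + s • w ∈ C := by
  rcases hs.eq_or_lt with rfl | hs'
  · simpa using hx
  have ht : 0 < t := hs'.trans_le hst
  have := hC.add_smul_mem hx h (t := s / t) ⟨by positivity, (div_le_one ht).2 hst⟩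
  rwa [smul_smul, div_mul_cancel₀ _ ht.ne'] at this

lemma add_mem_radialCone {C : Set X} (hC : Convex ℝ C) {x : X} (hx : x ∈ C) {w z : X}
    (hw : w ∈ radialCone C x) (hz : z ∈ radialCone C x) : w + z ∈ radialCone C x := by
  obtain ⟨s, hs, h⟩ := hw
  obtain ⟨t, ht, h'⟩ := hz
  have hm : 0 < min s t := lt_min hs ht
  refine ⟨min s t / 2, by positivity, ?_⟩
  have h1 := add_smul_mem_of_le hC hx hm.le (min_le_left s t) h
  have h2 := add_smul_mem_of_le hC hx hm.le (min_le_right s t) h'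
  have := hC h1 h2 (a := 1 / 2) (b := 1 / 2) (by norm_num) (by norm_num) (by norm_num)
  convert this using 1
  module

/-- The linear span of the radial cone, as the set of differences of radial directions. -/
def radialSpan {C : Set X} (hC : Convex ℝ C) {x : X} (hx : x ∈ C) : Submodule ℝ X where
  carrier := radialCone C x - radialCone C x
  zero_mem' := ⟨0, zero_mem_radialCone hx, 0, zero_mem_radialCone hx, sub_zero 0⟩
  add_mem' := by
    rintro _ _ ⟨a, ha, b, hb, rfl⟩ ⟨c, hc, d, hd, rfl⟩
    exact ⟨a + c, add_mem_radialCone hC hx ha hc, b + d, add_mem_radialCone hC hx hb hd,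
      add_sub_add_comm a c b d⟩
  smul_mem' := by
    rintro r _ ⟨a, ha, b, hb, rfl⟩
    rcases lt_trichotomy r 0 with hr | rfl | hr
    · refine ⟨(-r) • b, smul_mem_radialCone hb (neg_pos.2 hr), (-r) • a,
        smul_mem_radialCone ha (neg_pos.2 hr), ?_⟩
      module
    · exact ⟨0, zero_mem_radialCone hx, 0, zero_mem_radialCone hx, by simp⟩
    · exact ⟨r • a, smul_mem_radialCone ha hr, r • b, smul_mem_radialCone hb hr,
        (smul_sub r a b).symm⟩

lemma radialCone_subset_sub {C : Set X} {x y : X} (hy : y ∈ C) :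
    radialCone C y ⊆ radialCone C x - radialCone C x := by
  rintro w ⟨t, ht, h⟩
  refine ⟨t⁻¹ • (y + t • w - x), smul_mem_radialCone (sub_mem_radialCone h) (inv_pos.2 ht),
    t⁻¹ • (y - x), smul_mem_radialCone (sub_mem_radialCone hy) (inv_pos.2 ht), ?_⟩
  simp only [← smul_sub]
  rw [show y + t • w - x - (y - x) = t • w by abel, inv_smul_smul₀ ht.ne']

lemma WeakTendsto.exists_norm_le [CompleteSpace X] {ws : ℕ → X} {w : X}
    (h : WeakTendsto ws w) : ∃ M, ∀ k, ‖ws k‖ ≤ M := by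
  obtain ⟨M, hM⟩ := banach_steinhaus (g := fun k => innerSL ℝ (ws k)) fun z => by
    obtain ⟨M, hM⟩ := (h z).norm.bddAbove_range
    exact ⟨M, fun k => hM ⟨k, rfl⟩⟩
  exact ⟨M, fun k => by simpa using hM k⟩

lemma WeakTendsto.tendsto_inner [CompleteSpace X] {vs ws : ℕ → X} {v w : X}
    (hw : WeakTendsto ws w) (hv : Tendsto vs atTop (𝓝 v)) :
    Tendsto (fun k => ⟪vs k, ws k⟫) atTop (𝓝 ⟪v, w⟫) := by
  obtain ⟨M, hM⟩ := hw.exists_norm_le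
  have h0 : Tendsto (fun k => ⟪vs k - v, ws k⟫) atTop (𝓝 0) := by
    refine squeeze_zero_norm (a := fun k => ‖vs k - v‖ * M) (fun k => ?_) ?_
    · exact (norm_inner_le_norm _ _).trans (by gcongr; exact hM k)
    · simpa using (tendsto_iff_norm_sub_tendsto_zero.1 hv).mul_const M
  have := h0.add (hw v)
  simpa only [inner_sub_left, real_inner_comm v, sub_add_cancel, zero_add] using this

lemma WeakTendsto.mem_submodule [CompleteSpace X] {ws : ℕ → X} {w : X} (hw : WeakTendsto ws w)
    {K : Submodule ℝ X} (hK : IsClosed (K : Set X)) (h : ∀ k, ws k ∈ K) : w ∈ K := by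
  have : CompleteSpace K := hK.completeSpace_coe
  rw [← K.orthogonal_orthogonal, Submodule.mem_orthogonal']
  intro z hz
  have h0 : (fun k => ⟪ws k, z⟫) = fun _ => (0 : ℝ) :=
    funext fun k => (Submodule.mem_orthogonal K z).1 hz _ (h k)
  have := hw z
  rw [h0] at this
  exact tendsto_nhds_unique this tendsto_const_nhds

lemma Hw_subset_perp [CompleteSpace X] (C : Set X) (x v : X) :
    Hw C x v ⊆ {w | ⟪v, w⟫ = 0} := by
  rintro w ⟨xs, vs, ws, -, -, hv, hw, hww⟩
  have := hww.tendsto_inner hv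
  rw [funext fun k => (hw k).2] at this
  exact tendsto_nhds_unique this tendsto_const_nhds

lemma Hw_subset_closure [CompleteSpace X] {C : Set X} (hC : Convex ℝ C) {x : X} (hx : x ∈ C)
    (v : X) : Hw C x v ⊆ closure (tangentC C x - tangentC C x) := by
  rintro w ⟨xs, vs, ws, hN, -, -, hw, hww⟩
  have hmem : w ∈ (radialSpan hC hx).topologicalClosure :=
    hww.mem_submodule (Submodule.isClosed_topologicalClosure _) fun k =>
      closure_mono (radialCone_subset_sub (hN k).1) (hw k).1
  exact closure_mono (Set.sub_subset_sub subset_closure subset_closure) hmem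

lemma Hs_subset_Hw (C : Set X) (x v : X) : Hs C x v ⊆ Hw C x v := by
  rintro w ⟨xs, vs, ws, hN, hx, hv, hw, hww⟩
  exact ⟨xs, vs, ws, hN, hx, hv, hw, fun z => hww.inner tendsto_const_nhds⟩

lemma mem_convNC_add_smul {C : Set X} {x v w : X} {t : ℝ} (hv : v ∈ convNC C x)
    (hvw : ⟪v, w⟫ = 0) (hw : x + t • w ∈ C) : v ∈ convNC C (x + t • w) := by
  refine ⟨hw, fun y hy => ?_⟩
  have := hv.2 y hy
  rwa [← sub_sub, inner_sub_right, inner_smul_right, hvw, mul_zero, sub_zero]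

lemma criticalCone_sub_subset_Hs {C : Set X} (hC : Convex ℝ C) (hP : Polyhedric C) {x v : X}
    (hv : v ∈ convNC C x) : criticalCone C x v - criticalCone C x v ⊆ Hs C x v := by
  rintro _ ⟨w, hw, z, hz, rfl⟩
  rw [hP x hv.1 v hv] at hw hz
  obtain ⟨ws, hws, hwt⟩ := mem_closure_iff_seq_limit.1 hw
  obtain ⟨zs, hzs, hzt⟩ := mem_closure_iff_seq_limit.1 hz
  have key : ∀ k : ℕ, ∃ t : ℝ, 0 < t ∧ t ≤ 1 / ((k : ℝ) + 1) ∧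
      x + t • ws k ∈ C ∧ x + t • zs k ∈ C := by
    intro k
    obtain ⟨s, hs, h1⟩ := (hws k).1
    obtain ⟨r, hr, h2⟩ := (hzs k).1
    have hpos : 0 < min (min s r) (1 / ((k : ℝ) + 1)) :=
      lt_min (lt_min hs hr) (by positivity)
    exact ⟨_, hpos, min_le_right _ _,
      add_smul_mem_of_le hC hv.1 hpos.le ((min_le_left _ _).trans (min_le_left _ _)) h1,
      add_smul_mem_of_le hC hv.1 hpos.le ((min_le_left _ _).trans (min_le_right _ _)) h2⟩
  choose t ht htk htw htz using key
  have ht0 : Tendsto t atTop (𝓝 0) :=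
    squeeze_zero (fun k => (ht k).le) htk tendsto_one_div_add_atTop_nhds_zero_nat
  refine ⟨fun k => x + t k • zs k, fun _ => v, fun k => ws k - zs k,
    fun k => mem_convNC_add_smul hv (hzs k).2 (htz k), ?_, tendsto_const_nhds,
    fun k => ⟨subset_closure ⟨t k, ht k, ?_⟩, ?_⟩, hwt.sub hzt⟩
  · simpa using (ht0.smul hzt).const_add x
  · convert htw k using 1
    module
  · have h1 : ⟪v, ws k⟫ = 0 := (hws k).2
    have h2 : ⟪v, zs k⟫ = 0 := (hzs k).2
    simp [inner_sub_right, h1, h2]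

section Polyhedron

variable {n : ℕ} (a : Fin n → X) (b : Fin n → ℝ)

lemma radialCone_halfspaces {x : X} (hx : ∀ i, ⟪a i, x⟫ ≤ b i) :
    radialCone {x | ∀ i, ⟪a i, x⟫ ≤ b i} x = {w | ∀ i, ⟪a i, x⟫ = b i → ⟪a i, w⟫ ≤ 0} := by
  ext w
  constructor
  · rintro ⟨t, ht, h⟩ i hi
    have := h i
    rw [inner_add_right, inner_smul_right, hi] at this
    exact nonpos_of_mul_nonpos_right (by linarith) ht
  · intro h
    have hev : ∀ᶠ t in 𝓝[>] (0 : ℝ), ∀ i, ⟪a i, x + t • w⟫ ≤ b i := by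
      refine eventually_all.2 fun i => ?_
      rcases (hx i).eq_or_lt with hi | hi
      · filter_upwards [self_mem_nhdsWithin] with t ht
        rw [inner_add_right, inner_smul_right, hi]
        have := mul_nonpos_of_nonneg_of_nonpos (le_of_lt ht) (h i hi)
        linarith
      · have hc : Continuous fun t : ℝ => ⟪a i, x + t • w⟫ := by fun_prop
        have h0 : Tendsto (fun t : ℝ => ⟪a i, x + t • w⟫) (𝓝 0) (𝓝 ⟪a i, x⟫) := by
          simpa using hc.tendsto 0
        exact ((h0.eventually_lt_const hi).filter_mono nhdsWithin_le_nhds).mono fun _ => le_of_lt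
    obtain ⟨t, h1, h2⟩ := (hev.and self_mem_nhdsWithin).exists
    exact ⟨t, h2, h1⟩

lemma isClosed_radialCone_halfspaces {x : X} (hx : ∀ i, ⟪a i, x⟫ ≤ b i) :
    IsClosed (radialCone {x | ∀ i, ⟪a i, x⟫ ≤ b i} x) := by
  rw [radialCone_halfspaces a b hx]
  simp only [ofPred_forall]
  exact isClosed_iInter fun i => isClosed_iInter fun _ =>
    isClosed_le (continuous_const.inner continuous_id) continuous_const

end Polyhedron

lemma IsPolyhedron.polyhedric {C : Set X} (hC : IsPolyhedron C) : Polyhedric C := by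
  obtain ⟨n, a, b, rfl⟩ := hC
  intro x hx v _
  have hcl := isClosed_radialCone_halfspaces a b hx
  have hperp : IsClosed {w : X | ⟪v, w⟫ = 0} :=
    isClosed_eq (continuous_const.inner continuous_id) continuous_const
  rw [criticalCone, tangentC, hcl.closure_eq, (hcl.inter hperp).closure_eq]

lemma mem_convNC_iff_radialCone {C : Set X} {x v : X} (hx : x ∈ C) :
    v ∈ convNC C x ↔ ∀ w ∈ radialCone C x, ⟪v, w⟫ ≤ 0 := by
  refine ⟨?_, fun h => ⟨hx, fun y hy => h _ (sub_mem_radialCone hy)⟩⟩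
  rintro ⟨-, h⟩ w ⟨t, ht, hw⟩
  have := h _ hw
  rw [add_sub_cancel_left, inner_smul_right] at this
  exact nonpos_of_mul_nonpos_right this ht

lemma isClosed_convNC (C : Set X) (x : X) : IsClosed (convNC C x) := by
  by_cases hx : x ∈ C
  · simp only [convNC, hx, true_and, ofPred_forall]
    exact isClosed_iInter fun y => isClosed_iInter fun _ =>
      isClosed_le (continuous_id.inner continuous_const) continuous_const
  · simp [convNC, hx]

lemma mem_criticalCone_sub {C : Set X} {x y v w : X} (hv : v ∈ convNC C x)
    (hvy : v ∈ convNC C y) (hw : w ∈ radialCone C y) (hvw : ⟪v, w⟫ = 0) :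
    w ∈ criticalCone C x v - criticalCone C x v := by
  have h0 : ⟪v, y - x⟫ = 0 := by
    have h1 := hv.2 y hvy.1
    have h2 := hvy.2 x hv.1
    rw [← neg_sub, inner_neg_right] at h2
    linarith
  obtain ⟨t, ht, h⟩ := hw
  refine ⟨t⁻¹ • (y + t • w - x),
    ⟨subset_closure (smul_mem_radialCone (sub_mem_radialCone h) (inv_pos.2 ht)), ?_⟩,
    t⁻¹ • (y - x),
    ⟨subset_closure (smul_mem_radialCone (sub_mem_radialCone hvy.1) (inv_pos.2 ht)), ?_⟩, ?_⟩
  · have : y + t • w - x = (y - x) + t • w := by abel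
    simp [this, inner_smul_right, inner_add_right, h0, hvw]
  · simp [inner_smul_right, h0]
  · simp only [← smul_sub]
    rw [show y + t • w - x - (y - x) = t • w by abel, inv_smul_smul₀ ht.ne']

lemma Hw_subset_criticalCone_sub [CompleteSpace X] {C : Set X} (hC : IsPolyhedron C) {x v : X}
    (hv : v ∈ convNC C x) : Hw C x v ⊆ criticalCone C x v - criticalCone C x v := by
  intro w hw
  have hvw : ⟪v, w⟫ = 0 := Hw_subset_perp C x v hw
  obtain ⟨n, a, b, rfl⟩ := hC
  obtain ⟨xs, vs, ws, hN, -, hvs, hws, hww⟩ := hw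
  -- Some active index set occurs infinitely often along the sequence.
  obtain ⟨A, hA⟩ : ∃ A : Set (Fin n), ∃ᶠ k in atTop, {i | ⟪a i, xs k⟫ = b i} = A := by
    by_contra! hcon
    obtain ⟨k, hk⟩ := (eventually_all.2 hcon).exists
    exact hk _ rfl
  obtain ⟨m, hm⟩ := hA.exists
  have hR : ∀ k, {i | ⟪a i, xs k⟫ = b i} = A →
      radialCone {x | ∀ i, ⟪a i, x⟫ ≤ b i} (xs k) =
        radialCone {x | ∀ i, ⟪a i, x⟫ ≤ b i} (xs m) := by
    intro k hk
    rw [radialCone_halfspaces a b (hN k).1, radialCone_halfspaces a b (hN m).1]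
    ext z
    exact forall_congr' fun i => imp_congr_left (Set.ext_iff.1 (hk.trans hm.symm) i)
  have hvm : v ∈ convNC {x | ∀ i, ⟪a i, x⟫ ≤ b i} (xs m) := by
    refine (isClosed_convNC _ _).mem_of_frequently_of_tendsto (hA.mono fun k hk => ?_) hvs
    rw [mem_convNC_iff_radialCone (hN m).1, ← hR k hk, ← mem_convNC_iff_radialCone (hN k).1]
    exact hN k
  refine mem_criticalCone_sub hv hvm ?_ hvw
  rw [radialCone_halfspaces a b (hN m).1]
  intro i hi
  rw [real_inner_comm]
  refine isClosed_Iic.mem_of_frequently_of_tendsto (hA.mono fun k hk => ?_) (hww (a i))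
  have h1 : ws k ∈ radialCone {x | ∀ i, ⟪a i, x⟫ ≤ b i} (xs m) := by
    rw [← hR k hk, ← (isClosed_radialCone_halfspaces a b (hN k).1).closure_eq]
    exact (hws k).1
  rw [radialCone_halfspaces a b (hN m).1] at h1
  rw [mem_Iic, real_inner_comm]
  exact h1 i hi

end Auxiliary

/-- estimates of the weak and strong outer limits of critical
cones (Lemma 8.5). -/
theorem statement14
    {X : Type*} [NormedAddCommGroup X] [InnerProductSpace ℝ X] [CompleteSpace X]
    (C : Set X) (hCne : C.Nonempty) (hCcl : IsClosed C) (hCcv : Convex ℝ C)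
    (xb vh : X) (hxb : xb ∈ C) (hvh : vh ∈ convNC C xb) :
    (Hw C xb vh ⊆ closure (tangentC C xb - tangentC C xb) ∩ {w | ⟪vh, w⟫ = 0}) ∧
    (Polyhedric C → criticalCone C xb vh - criticalCone C xb vh ⊆ Hs C xb vh) ∧
    (FiniteDimensional ℝ X → IsPolyhedron C →
      Hs C xb vh = Hw C xb vh ∧
      Hw C xb vh = criticalCone C xb vh - criticalCone C xb vh) := by
  refine ⟨fun w hw => ⟨Hw_subset_closure hCcv hxb vh hw, Hw_subset_perp C xb vh hw⟩,
    fun hP => criticalCone_sub_subset_Hs hCcv hP hvh, fun _ hP => ?_⟩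
  have h1 := Hs_subset_Hw C xb vh
  have h2 := Hw_subset_criticalCone_sub hP hvh
  have h3 := criticalCone_sub_subset_Hs hCcv hP.polyhedric hvh
  exact ⟨h1.antisymm (h2.trans h3), h2.antisymm (h3.trans h1)⟩

end PVS
end
end

section
/- Let Ω ⊂ ℝⁿ be open, X = L²(Ω), and C := {x ∈ L²(Ω) : a ≤ x(y) ≤ b for a.e. y ∈ Ω} with −∞ ≤ a < b ≤ +∞. Consider the parametric variational inequality v ∈ f(x,p) + N_C(x) with reference solution x̄ ∈ Ŝ(v̄,p̄), f satisfying the standing assumptions, and suppose that Q(w) := ⟨∇_x f(x̄,p̄)w, w⟩ is a Legendre form on L²(Ω). Then x̄ is a fully stable solution corresponding to (v̄,p̄) if and only if ⟨∇_x f(x̄,p̄)w, w⟩ > 0 for every w ∈ L²(Ω) \ {0} such that w(y)·(v̄(y) − f(x̄,p̄)(y)) = 0 for a.e. y ∈ Ω. -/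
noncomputable section

open Filter Topology Metric Set MeasureTheory
open scoped RealInnerProductSpace Pointwise

namespace PVS

variable {X : Type*} [NormedAddCommGroup X] [InnerProductSpace ℝ X]
variable {Y : Type*} [NormedAddCommGroup Y] [InnerProductSpace ℝ Y]
variable {W : Type*} [NormedAddCommGroup W] [InnerProductSpace ℝ W]
variable {P : Type*} [MetricSpace P]
variable {Q : Type*} [MetricSpace Q]

/-- Contraction principle on a closed ball whose centre is moved by at most half the radius. -/
lemma exists_fixed_of_half_lipschitz {E : Type*} [NormedAddCommGroup E]
    [CompleteSpace E] {Φ : E → E} {c : E} {ρ : ℝ}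
    (hρ : 0 ≤ ρ) (hc : ‖Φ c - c‖ ≤ ρ / 2)
    (hΦ : ∀ x ∈ closedBall c ρ, ∀ y ∈ closedBall c ρ, ‖Φ x - Φ y‖ ≤ ‖x - y‖ / 2) :
    ∃ x ∈ closedBall c ρ, Φ x = x := by
  have hcc : c ∈ closedBall c ρ := mem_closedBall_self hρ
  have hmaps : MapsTo Φ (closedBall c ρ) (closedBall c ρ) := by
    intro x hx
    have h := hΦ x hx c hcc
    rw [mem_closedBall, dist_eq_norm] at hx ⊢
    calc ‖Φ x - c‖ ≤ ‖Φ x - Φ c‖ + ‖Φ c - c‖ := norm_sub_le_norm_sub_add_norm_sub _ _ _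
      _ ≤ ρ := by linarith
  have hcon : ContractingWith (1 / 2 : NNReal) (hmaps.restrict Φ _ _) := by
    refine ⟨by rw [← NNReal.coe_lt_coe]; norm_num, LipschitzWith.of_dist_le_mul fun x y => ?_⟩
    have h := hΦ x x.2 y y.2
    rw [Subtype.dist_eq, Subtype.dist_eq, dist_eq_norm, dist_eq_norm]
    simp only [MapsTo.val_restrict_apply]
    push_cast
    linarith
  obtain ⟨y, hy, hfix, -⟩ :=
    ContractingWith.exists_fixedPoint' isClosed_closedBall.isComplete hmaps hcon hcc
      (edist_ne_top _ _)
  exact ⟨y, hy, hfix⟩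

section Hilbert

variable {f : X → P → X} {C : Set X} {xb vb : X} {pb : P}

/-- Solutions of the variational inequality whose base is shifted by `s • (x - xb)`. -/
def shiftedSol (f : X → P → X) (C : Set X) (xb : X) (s : ℝ) (v : X) (p : P) : Set X :=
  {x | v - f x p - s • (x - xb) ∈ convNC C x}

lemma smul_mem_convNC {x v : X} {c : ℝ} (hc : 0 ≤ c) (hv : v ∈ convNC C x) :
    c • v ∈ convNC C x :=
  ⟨hv.1, fun y hy => by
    rw [real_inner_smul_left]; exact mul_nonpos_of_nonneg_of_nonpos hc (hv.2 y hy)⟩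

lemma inner_nonneg_of_mem_convNC {x₁ x₂ v₁ v₂ : X} (h₁ : v₁ ∈ convNC C x₁)
    (h₂ : v₂ ∈ convNC C x₂) : 0 ≤ ⟪v₁ - v₂, x₁ - x₂⟫ := by
  have e₁ := h₁.2 x₂ h₂.1
  have e₂ := h₂.2 x₁ h₁.1
  rw [← neg_sub, inner_neg_right] at e₁
  rw [inner_sub_left]
  linarith

lemma exists_sub_mem_convNC [CompleteSpace X] (hcl : IsClosed C) (hcv : Convex ℝ C)
    (hne : C.Nonempty) (u : X) : ∃ x, u - x ∈ convNC C x := by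
  obtain ⟨x, hx, h⟩ := exists_norm_eq_iInf_of_complete_convex hne hcl.isComplete hcv u
  exact ⟨x, hx, (norm_eq_iInf_iff_real_inner_le_zero hcv hx).1 h⟩

lemma norm_sub_le_of_sub_mem_convNC {u₁ u₂ x₁ x₂ : X} (h₁ : u₁ - x₁ ∈ convNC C x₁)
    (h₂ : u₂ - x₂ ∈ convNC C x₂) : ‖x₁ - x₂‖ ≤ ‖u₁ - u₂‖ := by
  have h := inner_nonneg_of_mem_convNC h₁ h₂
  have e : u₁ - x₁ - (u₂ - x₂) = (u₁ - u₂) - (x₁ - x₂) := by abel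
  rw [e, inner_sub_left, real_inner_self_eq_norm_sq] at h
  have h' := real_inner_le_norm (u₁ - u₂) (x₁ - x₂)
  by_contra! hlt
  nlinarith [norm_nonneg (u₁ - u₂)]

/-- Uniform strong-monotonicity estimate for all shifted solutions near the reference point. -/
def ShiftedMono (f : X → P → X) (C : Set X) (xb vb : X) (pb : P) (κ L r t : ℝ) : Prop :=
  ∀ s, 0 ≤ s → s ≤ t → ∀ x₁ x₂ v₁ v₂ p₁ p₂,
    ‖x₁ - xb‖ < r → ‖x₂ - xb‖ < r → ‖v₁ - vb‖ < r → ‖v₂ - vb‖ < r →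
    dist p₁ pb < r → dist p₂ pb < r →
    x₁ ∈ shiftedSol f C xb s v₁ p₁ → x₂ ∈ shiftedSol f C xb s v₂ p₂ →
    κ * ‖x₁ - x₂‖ ^ 2 ≤ ⟪v₁ - v₂, x₁ - x₂⟫ + L * dist p₁ p₂ * ‖x₁ - x₂‖

lemma norm_sub_le_of_inner_le {d e : X} {κ a : ℝ} (ha : 0 ≤ a)
    (h : κ * ‖d‖ ^ 2 ≤ ⟪e, d⟫ + a * ‖d‖) : κ * ‖d‖ ≤ ‖e‖ + a := by
  have h' := real_inner_le_norm e d
  rcases (norm_nonneg d).eq_or_lt with h0 | h0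
  · rw [← h0]; have := norm_nonneg e; linarith
  · refine le_of_mul_le_mul_right ?_ h0
    nlinarith

/-- Local solvability of the shifted variational inequality near the reference point. -/
def ShiftedSolvable (f : X → P → X) (C : Set X) (xb vb : X) (pb : P) (r s : ℝ) : Prop :=
  ∃ δ > (0:ℝ), δ ≤ r ∧ ∀ v p, ‖v - vb‖ < δ → dist p pb < δ →
    ∃ x, ‖x - xb‖ < r ∧ x ∈ shiftedSol f C xb s v p

omit [MetricSpace P] in
lemma self_mem_shiftedSol (hsol : xb ∈ SolMapVI f C vb pb) (s : ℝ) :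
    xb ∈ shiftedSol f C xb s vb pb := by
  simpa [shiftedSol, SolMapVI] using hsol

lemma ShiftedSolvable.sub [CompleteSpace X] {κ L r t s h : ℝ} (hκ : 0 < κ) (hL : 0 ≤ L)
    (hr : 0 < r) (hsol : xb ∈ SolMapVI f C vb pb) (hmono : ShiftedMono f C xb vb pb κ L r t)
    (hs : 0 ≤ s) (hst : s ≤ t) (hh : 0 ≤ h) (hhκ : h ≤ κ / 2)
    (hS : ShiftedSolvable f C xb vb pb r s) : ShiftedSolvable f C xb vb pb r (s - h) := by
  obtain ⟨δ, hδ, hδr, hex⟩ := hS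
  have hex' : ∀ v p, ∃ x, ‖v - vb‖ < δ → dist p pb < δ →
      ‖x - xb‖ < r ∧ x ∈ shiftedSol f C xb s v p := by
    intro v p
    by_cases hv : ‖v - vb‖ < δ ∧ dist p pb < δ
    · obtain ⟨x, hx⟩ := hex v p hv.1 hv.2
      exact ⟨x, fun _ _ => hx⟩
    · exact ⟨xb, fun h₁ h₂ => absurd ⟨h₁, h₂⟩ hv⟩
  choose θ hθ using hex'
  set ρ : ℝ := δ / (2 * (h + 1)) with hρdef
  have hρ : 0 < ρ := by positivity
  have hhρ : h * ρ < δ / 2 := by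
    have : (h + 1) * ρ = δ / 2 := by rw [hρdef]; field_simp
    nlinarith
  set δ' : ℝ := min (δ / 2) (κ * ρ / (2 * (1 + L))) with hδ'def
  have hδ' : 0 < δ' := by positivity
  have hδ'1 : δ' ≤ δ / 2 := min_le_left _ _
  have hδ'2 : δ' * (1 + L) ≤ κ * ρ / 2 := by
    have : δ' ≤ κ * ρ / (2 * (1 + L)) := min_le_right _ _
    calc δ' * (1 + L) ≤ κ * ρ / (2 * (1 + L)) * (1 + L) := by gcongr
      _ = κ * ρ / 2 := by field_simp
  refine ⟨δ', hδ', by linarith, fun v p hv hp => ?_⟩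
  have hin : ∀ x ∈ closedBall xb ρ, ‖v + h • (x - xb) - vb‖ < δ := by
    intro x hx
    rw [mem_closedBall, dist_eq_norm] at hx
    calc ‖v + h • (x - xb) - vb‖ = ‖(v - vb) + h • (x - xb)‖ := by congr 1; abel
      _ ≤ ‖v - vb‖ + h * ‖x - xb‖ := by
        refine (norm_add_le _ _).trans ?_
        rw [norm_smul, Real.norm_of_nonneg hh]
      _ ≤ ‖v - vb‖ + h * ρ := by gcongr
      _ < δ := by linarith
  have hpδ : dist p pb < δ := by linarith
  have hfp : ∃ x ∈ closedBall xb ρ, θ (v + h • (x - xb)) p = x := by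
    refine exists_fixed_of_half_lipschitz (Φ := fun x => θ (v + h • (x - xb)) p) hρ.le ?_ ?_
    · have hxb := hin xb (mem_closedBall_self hρ.le)
      obtain ⟨h₁, h₂⟩ := hθ _ p hxb hpδ
      simp only [sub_self, smul_zero, add_zero] at h₁ h₂ hxb ⊢
      have h₃ := hmono s hs hst _ xb v vb p pb h₁ (by simpa) (by linarith) (by simpa)
        (by linarith) (by simpa) h₂ (self_mem_shiftedSol hsol s)
      have h₄ := norm_sub_le_of_inner_le (by positivity) h₃
      have h₅ : L * dist p pb ≤ L * δ' := by gcongr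
      refine le_of_mul_le_mul_left ?_ hκ
      linarith
    · intro x hx y hy
      obtain ⟨h₁, h₂⟩ := hθ _ p (hin x hx) hpδ
      obtain ⟨k₁, k₂⟩ := hθ _ p (hin y hy) hpδ
      have hvx := hin x hx
      have hvy := hin y hy
      have h₃ := hmono s hs hst _ _ _ _ p p h₁ k₁ (by linarith) (by linarith)
        (by linarith) (by linarith) h₂ k₂
      have h₄ := norm_sub_le_of_inner_le (by positivity) h₃
      have e : v + h • (x - xb) - (v + h • (y - xb)) = h • (x - y) := by
        simp only [smul_sub]; abel
      rw [e, norm_smul, Real.norm_of_nonneg hh, dist_self, mul_zero, add_zero] at h₄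
      refine le_of_mul_le_mul_left ?_ hκ
      refine h₄.trans ?_
      nlinarith [norm_nonneg (x - y)]
  obtain ⟨x, hx, hfix⟩ := hfp
  obtain ⟨h₁, h₂⟩ := hθ _ p (hin x hx) hpδ
  rw [hfix] at h₁ h₂
  refine ⟨x, h₁, ?_⟩
  have e : v + h • (x - xb) - f x p - s • (x - xb) = v - f x p - (s - h) • (x - xb) := by
    rw [sub_smul]; abel
  simpa only [shiftedSol, mem_ofPred_eq, e] using h₂

lemma shiftedSolvable_of_large [CompleteSpace X] {L r t : ℝ} (hcl : IsClosed C)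
    (hcv : Convex ℝ C) (hL : 0 ≤ L) (hr : 0 < r) (ht : 0 < t) (htL : 2 * L ≤ t)
    (hsol : xb ∈ SolMapVI f C vb pb)
    (hlip : ∀ x₁ x₂ p₁ p₂, ‖x₁ - xb‖ < r → ‖x₂ - xb‖ < r → dist p₁ pb < r → dist p₂ pb < r →
      ‖f x₁ p₁ - f x₂ p₂‖ ≤ L * (‖x₁ - x₂‖ + dist p₁ p₂)) :
    ShiftedSolvable f C xb vb pb r t := by
  choose π hπ using exists_sub_mem_convNC hcl hcv ⟨xb, hsol.1⟩
  set ρ : ℝ := r / 2 with hρdef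
  have hρ : 0 < ρ := by positivity
  set δ : ℝ := min r (t * ρ / (2 * (1 + L))) with hδdef
  have hδ : 0 < δ := by positivity
  have hδr : δ ≤ r := min_le_left _ _
  have hδ2 : δ * (1 + L) ≤ t * ρ / 2 := by
    have : δ ≤ t * ρ / (2 * (1 + L)) := min_le_right _ _
    calc δ * (1 + L) ≤ t * ρ / (2 * (1 + L)) * (1 + L) := by gcongr
      _ = t * ρ / 2 := by field_simp
  refine ⟨δ, hδ, hδr, fun v p hv hp => ?_⟩
  have hball : ∀ x ∈ closedBall xb ρ, ‖x - xb‖ < r := by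
    intro x hx
    rw [mem_closedBall, dist_eq_norm] at hx
    linarith
  have hfp : ∃ x ∈ closedBall xb ρ, π (xb + t⁻¹ • (v - f x p)) = x := by
    refine exists_fixed_of_half_lipschitz (Φ := fun x => π (xb + t⁻¹ • (v - f x p))) hρ.le ?_ ?_
    · have h₁ : (xb + t⁻¹ • (vb - f xb pb)) - xb ∈ convNC C xb := by
        rw [add_sub_cancel_left]
        exact smul_mem_convNC (by positivity) hsol
      have h₂ := norm_sub_le_of_sub_mem_convNC (hπ (xb + t⁻¹ • (v - f xb p))) h₁
      have e : xb + t⁻¹ • (v - f xb p) - (xb + t⁻¹ • (vb - f xb pb))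
          = t⁻¹ • ((v - vb) - (f xb p - f xb pb)) := by
        simp only [smul_sub]; abel
      rw [e, norm_smul, Real.norm_of_nonneg (by positivity)] at h₂
      refine h₂.trans ?_
      rw [inv_mul_le_iff₀ ht]
      have h₃ := hlip xb xb p pb (by simpa) (by simpa) (by linarith) (by simpa)
      rw [sub_self, norm_zero, zero_add] at h₃
      have h₄ : L * dist p pb ≤ L * δ := by gcongr
      have h₅ := norm_sub_le (v - vb) (f xb p - f xb pb)
      linarith
    · intro x hx y hy
      have h₂ := norm_sub_le_of_sub_mem_convNC (hπ (xb + t⁻¹ • (v - f x p)))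
        (hπ (xb + t⁻¹ • (v - f y p)))
      have e : xb + t⁻¹ • (v - f x p) - (xb + t⁻¹ • (v - f y p)) = t⁻¹ • (f y p - f x p) := by
        simp only [smul_sub]; abel
      rw [e, norm_smul, Real.norm_of_nonneg (by positivity)] at h₂
      refine h₂.trans ?_
      rw [inv_mul_le_iff₀ ht]
      have h₃ := hlip y x p p (hball y hy) (hball x hx) (by linarith) (by linarith)
      rw [dist_self, add_zero, norm_sub_rev y x] at h₃
      nlinarith [norm_nonneg (x - y)]
  obtain ⟨x, hx, hfix⟩ := hfp
  refine ⟨x, hball x hx, ?_⟩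
  have h := hπ (xb + t⁻¹ • (v - f x p))
  rw [hfix] at h
  have h' := smul_mem_convNC ht.le h
  have e : t • (xb + t⁻¹ • (v - f x p) - x) = v - f x p - t • (x - xb) := by
    rw [smul_sub, smul_add, smul_smul, mul_inv_cancel₀ ht.ne', one_smul, smul_sub]; abel
  rwa [e] at h'

lemma shiftedSolvable_zero [CompleteSpace X] {κ L r : ℝ} {N : ℕ} (hκ : 0 < κ) (hL : 0 ≤ L)
    (hr : 0 < r) (hsol : xb ∈ SolMapVI f C vb pb)
    (hmono : ShiftedMono f C xb vb pb κ L r (N * (κ / 2)))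
    (hS : ShiftedSolvable f C xb vb pb r (N * (κ / 2))) :
    ShiftedSolvable f C xb vb pb r 0 := by
  have key : ∀ k : ℕ, k ≤ N → ShiftedSolvable f C xb vb pb r ((N - k) * (κ / 2)) := by
    intro k
    induction k with
    | zero => intro _; simpa using hS
    | succ k ih =>
      intro hk
      have hk' : (k : ℝ) ≤ N := by exact_mod_cast (Nat.le_of_succ_le hk)
      have h := (ih (Nat.le_of_succ_le hk)).sub hκ hL hr hsol hmono (h := κ / 2)
        (mul_nonneg (by linarith) (by positivity))
        (by gcongr; linarith [(Nat.cast_nonneg k : (0:ℝ) ≤ k)]) (by positivity) le_rfl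
      convert h using 1
      push_cast
      ring
  simpa using key N le_rfl

omit [InnerProductSpace ℝ X] in
lemma A1two.continuousAt {f : X → P → X} {xb : X} {pb : P} (h : A1two f xb pb) :
    ContinuousAt (fun x => f x pb) xb := by
  obtain ⟨L, hL, ε, hε, hlip⟩ := h
  refine continuousAt_of_locally_lipschitz hε L fun x hx => ?_
  rw [dist_eq_norm] at hx
  simpa [dist_eq_norm] using hlip x xb pb pb hx (by simpa) (by simpa) (by simpa)

lemma A4two.strict_estimate {f : X → P → X} {Df : X → P → X →L[ℝ] X} {xb : X} {pb : P}
    (h : A4two f Df xb pb) {ε : ℝ} (hε : 0 < ε) :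
    ∃ r > (0:ℝ), ∀ x₁ x₂ p, ‖x₁ - xb‖ < r → ‖x₂ - xb‖ < r → dist p pb < r →
      ‖f x₁ p - f x₂ p - Df xb pb (x₁ - x₂)‖ ≤ ε * ‖x₁ - x₂‖ := by
  obtain ⟨⟨η, hη, hdiff⟩, hcont⟩ := h
  obtain ⟨δ₁, hδ₁, hdiff⟩ := hdiff (ε / 2) (by positivity)
  obtain ⟨δ₂, hδ₂, hcont⟩ := Metric.tendsto_nhds_nhds.1 hcont (ε / 2) (by positivity)
  set r : ℝ := min η (min (δ₁ / 2) δ₂) with hrdef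
  have hr2 : r ≤ η := min_le_left _ _
  have hr3 : r ≤ δ₁ / 2 := (min_le_right _ _).trans (min_le_left _ _)
  have hr4 : r ≤ δ₂ := (min_le_right _ _).trans (min_le_right _ _)
  refine ⟨r, by positivity, fun x₁ x₂ p hx₁ hx₂ hp => ?_⟩
  have hdlt : ‖x₁ - x₂‖ < δ₁ := by
    have : ‖x₁ - x₂‖ ≤ ‖x₁ - xb‖ + ‖x₂ - xb‖ := by
      rw [norm_sub_rev x₂ xb]; exact norm_sub_le_norm_sub_add_norm_sub _ _ _
    linarith
  have hT := hdiff x₂ p (by linarith) (by linarith) x₁ hdlt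
  have hD : ‖Df x₂ p - Df xb pb‖ ≤ ε / 2 := by
    have := hcont (x := (x₂, p)) (by
      rw [Prod.dist_eq, dist_eq_norm]
      exact max_lt (by linarith) (by linarith))
    rw [dist_eq_norm] at this
    exact this.le
  have hD' := (Df x₂ p - Df xb pb).le_of_opNorm_le hD (x₁ - x₂)
  have e : f x₁ p - f x₂ p - Df xb pb (x₁ - x₂)
      = (f x₁ p - f x₂ p - Df x₂ p (x₁ - x₂)) + (Df x₂ p - Df xb pb) (x₁ - x₂) := by
    rw [_root_.sub_apply]; abel
  rw [e]
  refine (norm_add_le _ _).trans ?_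
  linarith

/-- Coercivity of the derivative along differences of nearby points of the graph of the normal
cone gives strong monotonicity of all shifted systems, uniformly in the shift. -/
lemma exists_shiftedMono {Df : X → P → X →L[ℝ] X} {ε L ε₁ t : ℝ} (hε : 0 < ε) (hL : 0 < L)
    (hε₁ : 0 < ε₁) (ht : 0 ≤ t)
    (hlip : ∀ x₁ x₂ p₁ p₂, ‖x₁ - xb‖ < ε₁ → ‖x₂ - xb‖ < ε₁ → dist p₁ pb < ε₁ →
      dist p₂ pb < ε₁ → ‖f x₁ p₁ - f x₂ p₂‖ ≤ L * (‖x₁ - x₂‖ + dist p₁ p₂))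
    (hA4 : A4two f Df xb pb)
    (hcoer : ∀ x₁ x₂ v₁ v₂, v₁ ∈ convNC C x₁ → v₂ ∈ convNC C x₂ →
      ‖v₁ - (vb - f xb pb)‖ < ε → ‖v₂ - (vb - f xb pb)‖ < ε →
      ε * ‖x₁ - x₂‖ ^ 2 ≤ ⟪Df xb pb (x₁ - x₂), x₁ - x₂⟫) :
    ∃ r > 0, r ≤ ε₁ ∧ ShiftedMono f C xb vb pb (ε / 2) L r t := by
  obtain ⟨η, hη, hdiff⟩ := hA4.strict_estimate (half_pos hε)
  have hc : 0 < 1 + 2 * L + t := by positivity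
  set r : ℝ := min (min ε₁ η) (ε / (1 + 2 * L + t)) with hrdef
  have hr : 0 < r := by positivity
  have hr1 : r ≤ ε₁ := (min_le_left _ _).trans (min_le_left _ _)
  have hr2 : r ≤ η := (min_le_left _ _).trans (min_le_right _ _)
  have hr5 : r * (1 + 2 * L + t) ≤ ε := by
    rw [← le_div_iff₀ hc]
    exact min_le_right _ _
  refine ⟨r, hr, hr1, ?_⟩
  intro s hs hst x₁ x₂ v₁ v₂ p₁ p₂ hx₁ hx₂ hv₁ hv₂ hp₁ hp₂ h₁ h₂
  have hnear : ∀ x v p, ‖x - xb‖ < r → ‖v - vb‖ < r → dist p pb < r →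
      ‖v - f x p - s • (x - xb) - (vb - f xb pb)‖ < ε := by
    intro x v p hx hv hp
    have e : v - f x p - s • (x - xb) - (vb - f xb pb)
        = (v - vb) - (f x p - f xb pb) - s • (x - xb) := by abel
    have k₁ := hlip x xb p pb (by linarith) (by simpa) (by linarith) (by simpa)
    have k₂ := norm_sub_le ((v - vb) - (f x p - f xb pb)) (s • (x - xb))
    have k₃ := norm_sub_le (v - vb) (f x p - f xb pb)
    rw [norm_smul, Real.norm_of_nonneg hs] at k₂
    have k₄ : s * ‖x - xb‖ ≤ t * r := mul_le_mul hst hx.le (norm_nonneg _) ht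
    have k₅ : L * (‖x - xb‖ + dist p pb) ≤ L * (r + r) := by gcongr
    rw [e]
    nlinarith
  have hco := hcoer x₁ x₂ _ _ h₁ h₂ (hnear x₁ v₁ p₁ hx₁ hv₁ hp₁) (hnear x₂ v₂ p₂ hx₂ hv₂ hp₂)
  have hmon := inner_nonneg_of_mem_convNC h₁ h₂
  set d := x₁ - x₂ with hd
  have hT := hdiff x₁ x₂ p₁ (by linarith) (by linarith) (by linarith)
  have hp : ‖f x₂ p₁ - f x₂ p₂‖ ≤ L * dist p₁ p₂ := by
    simpa using hlip x₂ x₂ p₁ p₂ (by linarith) (by linarith) (by linarith) (by linarith)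
  have e : v₁ - f x₁ p₁ - s • (x₁ - xb) - (v₂ - f x₂ p₂ - s • (x₂ - xb))
      = (v₁ - v₂) - (f x₁ p₁ - f x₂ p₁ - Df xb pb d) - Df xb pb d
        - (f x₂ p₁ - f x₂ p₂) - s • d := by
    rw [hd]
    simp only [smul_sub]
    abel
  rw [e] at hmon
  simp only [inner_sub_left (_ - _ : X), real_inner_smul_left, real_inner_self_eq_norm_sq] at hmon
  have i₁ : -⟪f x₁ p₁ - f x₂ p₁ - Df xb pb d, d⟫ ≤ ε / 2 * ‖d‖ ^ 2 := by
    rw [← inner_neg_left]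
    refine (real_inner_le_norm _ _).trans ?_
    rw [norm_neg]
    nlinarith [norm_nonneg d]
  have i₃ : -⟪f x₂ p₁ - f x₂ p₂, d⟫ ≤ L * dist p₁ p₂ * ‖d‖ := by
    rw [← inner_neg_left]
    refine (real_inner_le_norm _ _).trans ?_
    rw [norm_neg]
    gcongr
  have i₄ : 0 ≤ s * ‖d‖ ^ 2 := by positivity
  simp only [inner_sub_left] at hmon i₁ i₃ ⊢
  linarith

theorem fullStable2_of_coercive [CompleteSpace X] {Df : X → P → X →L[ℝ] X} {ε : ℝ}
    (hcl : IsClosed C) (hcv : Convex ℝ C) (hsol : xb ∈ SolMapVI f C vb pb)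
    (hA1 : A1two f xb pb) (hA4 : A4two f Df xb pb) (hε : 0 < ε)
    (hcoer : ∀ x₁ x₂ v₁ v₂, v₁ ∈ convNC C x₁ → v₂ ∈ convNC C x₂ →
      ‖v₁ - (vb - f xb pb)‖ < ε → ‖v₂ - (vb - f xb pb)‖ < ε →
      ε * ‖x₁ - x₂‖ ^ 2 ≤ ⟪Df xb pb (x₁ - x₂), x₁ - x₂⟫) :
    FullStable2 (SolMapVI f C) xb vb pb := by
  obtain ⟨L, hL, ε₁, hε₁, hlip⟩ := hA1
  set κ : ℝ := ε / 2 with hκdef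
  have hκ : 0 < κ := by positivity
  obtain ⟨N, hN⟩ := exists_nat_ge ((2 * L) / (κ / 2))
  rw [div_le_iff₀ (by positivity)] at hN
  obtain ⟨r, hr, hrε₁, hmono⟩ := exists_shiftedMono (t := N * (κ / 2)) hε hL hε₁ (by positivity)
    hlip hA4 hcoer
  rw [← hκdef] at hmono
  have hlarge : ShiftedSolvable f C xb vb pb r (N * (κ / 2)) :=
    shiftedSolvable_of_large hcl hcv hL.le hr (by linarith) hN hsol
      fun x₁ x₂ p₁ p₂ h₁ h₂ h₃ h₄ => hlip x₁ x₂ p₁ p₂ (h₁.trans_le hrε₁) (h₂.trans_le hrε₁)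
        (h₃.trans_le hrε₁) (h₄.trans_le hrε₁)
  obtain ⟨δ, hδ, hδr, hex⟩ := shiftedSolvable_zero hκ hL.le hr hsol hmono hlarge
  have hshift : ∀ v p, shiftedSol f C xb 0 v p = SolMapVI f C v p := by
    intro v p; ext x; simp [shiftedSol, SolMapVI]
  simp only [hshift] at hex
  have hmono0 := hmono 0 le_rfl (by positivity)
  simp only [hshift] at hmono0
  have hex' : ∀ v p, ∃ x, ‖v - vb‖ < δ → dist p pb < δ →
      ‖x - xb‖ < r ∧ x ∈ SolMapVI f C v p := by
    intro v p
    by_cases hv : ‖v - vb‖ < δ ∧ dist p pb < δ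
    · obtain ⟨x, hx⟩ := hex v p hv.1 hv.2
      exact ⟨x, fun _ _ => hx⟩
    · exact ⟨xb, fun h₁ h₂ => absurd ⟨h₁, h₂⟩ hv⟩
  choose θ hθ using hex'
  refine ⟨ball vb δ, ball_mem_nhds _ hδ, ball pb δ, ball_mem_nhds _ hδ, ball xb r,
    ball_mem_nhds _ hr, θ, ?_, κ / 2, by positivity, L, hL, ?_⟩
  · intro v hv p hp
    rw [mem_ball, dist_eq_norm] at hv
    rw [mem_ball] at hp
    obtain ⟨h₁, h₂⟩ := hθ v p hv hp
    refine ⟨by rwa [mem_ball, dist_eq_norm], h₂, fun x hx hxS => ?_⟩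
    rw [mem_ball, dist_eq_norm] at hx
    have h := hmono0 x (θ v p) v v p p hx h₁ (by linarith) (by linarith) (by linarith)
      (by linarith) hxS h₂
    simp only [sub_self, inner_zero_left, dist_self, mul_zero, zero_mul, add_zero] at h
    have : ‖x - θ v p‖ ^ 2 ≤ 0 := nonpos_of_mul_nonpos_right h hκ
    have : ‖x - θ v p‖ = 0 := by
      have h0 := sq_nonneg ‖x - θ v p‖
      exact pow_eq_zero_iff two_ne_zero |>.1 (le_antisymm this h0)
    exact sub_eq_zero.1 (norm_eq_zero.1 this)
  · intro v₁ hv₁ p₁ hp₁ v₂ hv₂ p₂ hp₂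
    rw [mem_ball, dist_eq_norm] at hv₁ hv₂
    rw [mem_ball] at hp₁ hp₂
    obtain ⟨h₁, h₂⟩ := hθ v₁ p₁ hv₁ hp₁
    obtain ⟨k₁, k₂⟩ := hθ v₂ p₂ hv₂ hp₂
    have h := hmono0 _ _ v₁ v₂ p₁ p₂ h₁ k₁ (by linarith) (by linarith) (by linarith)
      (by linarith) h₂ k₂
    have hD : 0 ≤ L * dist p₁ p₂ := by positivity
    refine abs_le_of_sq_le_sq' ?_ (by positivity) |>.2
    rw [norm_sub_sq_real, real_inner_smul_right, norm_smul, Real.norm_of_nonneg (by positivity)]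
    nlinarith [sq_nonneg (κ * ‖θ v₁ p₁ - θ v₂ p₂‖ - L * dist p₁ p₂),
      mul_le_mul_of_nonneg_left h hκ.le, mul_nonneg hD (norm_nonneg (v₁ - v₂))]

/-- Full stability forces strong monotonicity of the base along solution differences. -/
theorem FullStable2.exists_inner_le (hstab : FullStable2 (SolMapVI f C) xb vb pb)
    (hf : ContinuousAt (fun x => f x pb) xb) :
    ∃ κ > (0:ℝ), ∃ ε > (0:ℝ), ∀ x₁ x₂, ‖x₁ - xb‖ < ε → ‖x₂ - xb‖ < ε →
      vb - f xb pb ∈ convNC C x₁ → vb - f xb pb ∈ convNC C x₂ →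
      κ * ‖x₁ - x₂‖ ^ 2 ≤ ⟪f x₁ pb - f x₂ pb, x₁ - x₂⟫ := by
  obtain ⟨V, hV, Pn, hPn, U, hU, θ, hloc, κ, hκ, ℓ, hℓ, hest⟩ := hstab
  have hpb := mem_of_mem_nhds hPn
  have hv : Tendsto (fun x => f x pb + (vb - f xb pb)) (𝓝 xb) (𝓝 vb) := by
    simpa using hf.tendsto.add_const (vb - f xb pb)
  obtain ⟨ε, hε, hball⟩ := Metric.eventually_nhds_iff.1 ((hv.eventually_mem hV).and hU)
  refine ⟨κ, hκ, ε, hε, fun x₁ x₂ hx₁ hx₂ hn₁ hn₂ => ?_⟩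
  have huniq : ∀ x, ‖x - xb‖ < ε → vb - f xb pb ∈ convNC C x →
      f x pb + (vb - f xb pb) ∈ V ∧ θ (f x pb + (vb - f xb pb)) pb = x := by
    intro x hx hn
    obtain ⟨h₁, h₂⟩ := hball (by rwa [dist_eq_norm] : dist x xb < ε)
    refine ⟨h₁, ((hloc _ h₁ pb hpb).2.2 x h₂ ?_).symm⟩
    simpa [SolMapVI] using hn
  obtain ⟨m₁, e₁⟩ := huniq x₁ hx₁ hn₁
  obtain ⟨m₂, e₂⟩ := huniq x₂ hx₂ hn₂
  have h := hest _ m₁ pb hpb _ m₂ pb hpb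
  rw [e₁, e₂, dist_self, mul_zero, add_zero, add_sub_add_right_eq_sub] at h
  have h' := pow_le_pow_left₀ (norm_nonneg _) h 2
  rw [norm_sub_sq_real, real_inner_smul_right, norm_smul, Real.norm_of_nonneg (by positivity)] at h'
  refine le_of_mul_le_mul_left ?_ hκ
  nlinarith

/-- Sequential weak compactness of bounded sets in a separable Hilbert space. -/
lemma exists_weakTendsto_subseq [CompleteSpace X] [TopologicalSpace.SeparableSpace X]
    {w : ℕ → X} {M : ℝ} (hw : ∀ k, ‖w k‖ ≤ M) :
    ∃ (x : X) (φ : ℕ → ℕ), StrictMono φ ∧ WeakTendsto (w ∘ φ) x := by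
  obtain ⟨T, -, φ, hφ, hT⟩ := WeakDual.isSeqCompact_closedBall ℝ X (0 : StrongDual ℝ X) M
    (x := fun k => StrongDual.toWeakDual (InnerProductSpace.toDual ℝ X (w k))) (fun k => by
      simpa using hw k)
  refine ⟨(InnerProductSpace.toDual ℝ X).symm (WeakDual.toStrongDual T), φ, hφ, fun z => ?_⟩
  rw [InnerProductSpace.toDual_symm_apply]
  exact ((WeakDual.eval_continuous z).tendsto T).comp hT

/-- A Legendre form that is positive at all nonzero weak limits of a sequence of unit vectors
cannot have nonpositive values in the limit along that sequence. -/
lemma LegendreForm.exists_weak_limit_nonpos [CompleteSpace X]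
    [TopologicalSpace.SeparableSpace X] {A : X →L[ℝ] X} (hA : LegendreForm fun w => ⟪A w, w⟫)
    {w : ℕ → X} {c : ℕ → ℝ} (hw : ∀ k, ‖w k‖ = 1) (hc : Tendsto c atTop (𝓝 0))
    (hwc : ∀ k, ⟪A (w k), w k⟫ ≤ c k) :
    ∃ (x : X) (φ : ℕ → ℕ), StrictMono φ ∧ WeakTendsto (w ∘ φ) x ∧ x ≠ 0 ∧ ⟪A x, x⟫ ≤ 0 := by
  obtain ⟨-, hlsc, hstrong⟩ := hA
  obtain ⟨x, φ, hφ, hx⟩ := exists_weakTendsto_subseq (fun k => (hw k).le)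
  have hbd : ∀ k, ⟪A (w (φ k)), w (φ k)⟫ ∈ Icc (-‖A‖) ‖A‖ := by
    intro k
    rw [mem_Icc, ← abs_le]
    refine (abs_real_inner_le_norm _ _).trans ?_
    have := A.le_opNorm (w (φ k))
    rw [hw, mul_one] at *
    exact this
  obtain ⟨q, -, ψ, hψ, hq⟩ := isCompact_Icc.tendsto_subseq hbd
  have hx' : WeakTendsto (w ∘ (φ ∘ ψ)) x := fun z => (hx z).comp hψ.tendsto_atTop
  have hφψ : StrictMono (φ ∘ ψ) := hφ.comp hψ
  have hq0 : q ≤ 0 := le_of_tendsto_of_tendsto' hq (hc.comp hφψ.tendsto_atTop) fun k => hwc _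
  have hxq : ⟪A x, x⟫ ≤ q := (hlsc _ x hx').trans_eq hq.liminf_eq
  refine ⟨x, φ ∘ ψ, hφψ, hx', ?_, hxq.trans hq0⟩
  rintro rfl
  simp only [inner_zero_right] at hxq
  have hqz : q = 0 := le_antisymm hq0 hxq
  subst hqz
  have hlim := hstrong _ 0 hx' (by simpa [Function.comp_def] using hq)
  have h1 : Tendsto (fun _ : ℕ => (1 : ℝ)) atTop (𝓝 ‖(0 : X)‖) := by
    simpa [Function.comp_def, hw] using hlim.norm
  simpa using tendsto_nhds_unique h1 tendsto_const_nhds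

end Hilbert

section Lp

variable {α : Type*} [MeasurableSpace α] {μ : Measure α}

/-- Restriction of an `L²` function to a measurable set, extended by zero. -/
def lpRestrict (S : Set α) (hS : MeasurableSet S) (f : Lp ℝ 2 μ) : Lp ℝ 2 μ :=
  ((Lp.memLp f).indicator hS).toLp _

lemma coeFn_lpRestrict {S : Set α} (hS : MeasurableSet S) (f : Lp ℝ 2 μ) :
    lpRestrict S hS f =ᵐ[μ] S.indicator f :=
  MemLp.coeFn_toLp _

lemma norm_lpRestrict_le {S : Set α} (hS : MeasurableSet S) (f : Lp ℝ 2 μ) :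
    ‖lpRestrict S hS f‖ ≤ ‖f‖ := by
  refine Lp.norm_le_norm_of_ae_le ?_
  filter_upwards [coeFn_lpRestrict hS f] with y hy
  rw [hy]
  exact norm_indicator_le_norm_self _ _

lemma inner_eq_integral_mul (f g : Lp ℝ 2 μ) : ⟪f, g⟫ = ∫ y, f y * g y ∂μ := by
  rw [L2.inner_def]
  simp [mul_comm]

lemma integrable_coeFn_mul (f g : Lp ℝ 2 μ) : Integrable (fun y => f y * g y) μ := by
  have h := L2.integrable_inner (𝕜 := ℝ) f g
  simpa [mul_comm] using h

lemma inner_lpRestrict {S : Set α} (hS : MeasurableSet S) (f g : Lp ℝ 2 μ) :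
    ⟪f, lpRestrict S hS g⟫ = ∫ y in S, f y * g y ∂μ := by
  rw [inner_eq_integral_mul, ← integral_indicator hS]
  refine integral_congr_ae ?_
  filter_upwards [coeFn_lpRestrict hS g] with y hy
  rw [hy]
  by_cases h : y ∈ S <;> simp [h]

lemma mul_ae_eq_zero_of_inner_lpRestrict {f g : Lp ℝ 2 μ}
    (h : ∀ S (hS : MeasurableSet S), ⟪f, lpRestrict S hS g⟫ = 0) :
    ∀ᵐ y ∂μ, f y * g y = 0 := by
  refine (integrable_coeFn_mul f g).ae_eq_zero_of_forall_setIntegral_eq_zero fun S hS _ => ?_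
  rw [← inner_lpRestrict hS]
  exact h S hS

lemma inner_lpRestrict_eq_zero {f g : Lp ℝ 2 μ} (h : ∀ᵐ y ∂μ, f y * g y = 0) {S : Set α}
    (hS : MeasurableSet S) : ⟪f, lpRestrict S hS g⟫ = 0 := by
  rw [inner_lpRestrict hS]
  exact integral_eq_zero_of_ae (ae_restrict_of_ae h)

lemma inner_abs_le (f g : Lp ℝ 2 μ) : ∫ y, |f y| * |g y| ∂μ ≤ ‖f‖ * ‖g‖ := by
  have h := real_inner_le_norm |f| |g|
  rw [norm_abs_eq_norm, norm_abs_eq_norm, inner_eq_integral_mul] at h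
  refine le_of_eq_of_le (integral_congr_ae ?_) h
  filter_upwards [Lp.coeFn_abs f, Lp.coeFn_abs g] with y h₁ h₂
  rw [h₁, h₂]

/-- The `L²` functions with values almost everywhere in a given set of reals. -/
def pointwiseSet (μ : Measure α) (I : Set ℝ) : Set (Lp ℝ 2 μ) := {x | ∀ᵐ y ∂μ, x y ∈ I}

lemma isClosed_pointwiseSet {I : Set ℝ} (hI : IsClosed I) : IsClosed (pointwiseSet μ I) := by
  refine IsSeqClosed.isClosed fun x x₀ hx hlim => ?_
  obtain ⟨φ, -, hφ⟩ := (tendstoInMeasure_of_tendsto_Lp hlim).exists_seq_tendsto_ae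
  filter_upwards [ae_all_iff.2 hx, hφ] with y h₁ h₂
  exact hI.mem_of_tendsto h₂ (Eventually.of_forall fun k => h₁ _)

lemma convex_pointwiseSet {I : Set ℝ} (hI : Convex ℝ I) : Convex ℝ (pointwiseSet μ I) := by
  intro x hx z hz s t hs ht hst
  filter_upwards [hx, hz, Lp.coeFn_add (s • x) (t • z), Lp.coeFn_smul s x, Lp.coeFn_smul t z]
    with y h₁ h₂ h₃ h₄ h₅
  rw [h₃, Pi.add_apply, h₄, h₅]
  exact hI h₁ h₂ hs ht hst

lemma add_lpRestrict_mem_pointwiseSet {I : Set ℝ} {x u : Lp ℝ 2 μ} (hx : x ∈ pointwiseSet μ I)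
    {S : Set α} (hS : MeasurableSet S) (h : ∀ᵐ y ∂μ, y ∈ S → x y + u y ∈ I) :
    x + lpRestrict S hS u ∈ pointwiseSet μ I := by
  filter_upwards [hx, h, Lp.coeFn_add x (lpRestrict S hS u), coeFn_lpRestrict hS u]
    with y h₁ h₂ h₃ h₄
  rw [h₃, Pi.add_apply, h₄]
  by_cases hy : y ∈ S
  · simpa [hy] using h₂ hy
  · simpa [hy] using h₁

lemma mul_sub_nonpos_of_mem_convNC {I : Set ℝ} {x z v : Lp ℝ 2 μ}
    (hv : v ∈ convNC (pointwiseSet μ I) x) (hz : z ∈ pointwiseSet μ I) :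
    ∀ᵐ y ∂μ, v y * (z y - x y) ≤ 0 := by
  have h : 0 ≤ᵐ[μ] fun y => -(v y * (z - x : Lp ℝ 2 μ) y) := by
    refine ae_nonneg_of_forall_setIntegral_nonneg (integrable_coeFn_mul v (z - x)).neg
      fun S hS _ => ?_
    rw [integral_neg, ← inner_lpRestrict hS, neg_nonneg]
    have hm : x + lpRestrict S hS (z - x) ∈ pointwiseSet μ I := by
      refine add_lpRestrict_mem_pointwiseSet hv.1 hS ?_
      filter_upwards [hz, Lp.coeFn_sub z x] with y h₁ h₂ _
      rw [h₂, Pi.sub_apply, add_sub_cancel]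
      exact h₁
    simpa using hv.2 _ hm
  filter_upwards [h, Lp.coeFn_sub z x] with y h₁ h₂
  rw [h₂, Pi.sub_apply] at h₁
  simpa using h₁

lemma abs_mul_abs_le_of_sign {d v₁ v₂ u : ℝ} (h₁ : 0 ≤ v₁ * d) (h₂ : v₂ * d ≤ 0) :
    |d| * |u| ≤ |d| * |v₁ - u| + |d| * |v₂ - u| := by
  rw [← abs_mul, ← abs_mul, ← abs_mul]
  have e₁ : d * (v₁ - u) = v₁ * d - d * u := by ring
  have e₂ : d * (v₂ - u) = v₂ * d - d * u := by ring
  rw [e₁, e₂]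
  rcases abs_cases (d * u) with h | h <;> rcases abs_cases (v₁ * d - d * u) with h' | h' <;>
    rcases abs_cases (v₂ * d - d * u) with h'' | h'' <;> linarith

/-- Differences of points with nearby normals are almost orthogonal to the reference normal. -/
lemma abs_inner_lpRestrict_le {I : Set ℝ} {x₁ x₂ v₁ v₂ u : Lp ℝ 2 μ}
    (h₁ : v₁ ∈ convNC (pointwiseSet μ I) x₁) (h₂ : v₂ ∈ convNC (pointwiseSet μ I) x₂)
    {S : Set α} (hS : MeasurableSet S) :
    |⟪x₁ - x₂, lpRestrict S hS u⟫| ≤ ‖x₁ - x₂‖ * (‖v₁ - u‖ + ‖v₂ - u‖) := by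
  have hfg : ∀ f g : Lp ℝ 2 μ, Integrable (fun y => |f y| * |g y|) μ := fun f g => by
    simpa [abs_mul] using (integrable_coeFn_mul f g).abs
  rw [inner_lpRestrict hS]
  calc |∫ y in S, (x₁ - x₂ : Lp ℝ 2 μ) y * u y ∂μ|
      ≤ ∫ y in S, |(x₁ - x₂ : Lp ℝ 2 μ) y| * |u y| ∂μ := by
        refine abs_integral_le_integral_abs.trans_eq ?_
        simp [abs_mul]
    _ ≤ ∫ y, |(x₁ - x₂ : Lp ℝ 2 μ) y| * |u y| ∂μ :=
        setIntegral_le_integral (hfg _ _) (Eventually.of_forall fun y => by positivity)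
    _ ≤ ∫ y, (|(x₁ - x₂ : Lp ℝ 2 μ) y| * |(v₁ - u : Lp ℝ 2 μ) y|
          + |(x₁ - x₂ : Lp ℝ 2 μ) y| * |(v₂ - u : Lp ℝ 2 μ) y|) ∂μ := by
        refine integral_mono_ae (hfg _ _) ((hfg _ _).add (hfg _ _)) ?_
        filter_upwards [mul_sub_nonpos_of_mem_convNC h₁ h₂.1, mul_sub_nonpos_of_mem_convNC h₂ h₁.1,
          Lp.coeFn_sub x₁ x₂, Lp.coeFn_sub v₁ u, Lp.coeFn_sub v₂ u] with y k₁ k₂ k₃ k₄ k₅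
        simp only [k₃, k₄, k₅, Pi.sub_apply]
        exact abs_mul_abs_le_of_sign (by linarith) k₂
    _ ≤ ‖x₁ - x₂‖ * (‖v₁ - u‖ + ‖v₂ - u‖) := by
        rw [integral_add (hfg _ _) (hfg _ _), mul_add]
        exact add_le_add (inner_abs_le _ _) (inner_abs_le _ _)

/-- Positivity of a Legendre form on the functions supported in `{u = 0}` yields coercivity along
differences of points whose normals are close to `u`. -/
theorem exists_coercive_of_legendreForm [TopologicalSpace.SeparableSpace (Lp ℝ 2 μ)]
    {I : Set ℝ} {A : Lp ℝ 2 μ →L[ℝ] Lp ℝ 2 μ} (hA : LegendreForm fun w => ⟪A w, w⟫)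
    {u : Lp ℝ 2 μ}
    (hpos : ∀ w : Lp ℝ 2 μ, w ≠ 0 → (∀ᵐ y ∂μ, w y * u y = 0) → 0 < ⟪A w, w⟫) :
    ∃ ε > (0:ℝ), ∀ x₁ x₂ v₁ v₂, v₁ ∈ convNC (pointwiseSet μ I) x₁ →
      v₂ ∈ convNC (pointwiseSet μ I) x₂ → ‖v₁ - u‖ < ε → ‖v₂ - u‖ < ε →
      ε * ‖x₁ - x₂‖ ^ 2 ≤ ⟪A (x₁ - x₂), x₁ - x₂⟫ := by
  by_contra! hcon
  set c : ℕ → ℝ := fun k => 1 / ((k : ℝ) + 1) with hcdef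
  have hc : Tendsto c atTop (𝓝 0) := tendsto_one_div_add_atTop_nhds_zero_nat
  choose x₁ x₂ v₁ v₂ h₁ h₂ hv₁ hv₂ hlt using fun k : ℕ => hcon (c k) Nat.one_div_pos_of_nat
  have hd : ∀ k, 0 < ‖x₁ k - x₂ k‖ := by
    intro k
    rw [norm_pos_iff]
    intro h0
    simpa [h0] using hlt k
  set w : ℕ → Lp ℝ 2 μ := fun k => ‖x₁ k - x₂ k‖⁻¹ • (x₁ k - x₂ k) with hwdef
  have hw : ∀ k, ‖w k‖ = 1 := fun k => by
    rw [hwdef, norm_smul, norm_inv, norm_norm, inv_mul_cancel₀ (hd k).ne']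
  have hwc : ∀ k, ⟪A (w k), w k⟫ ≤ c k := by
    intro k
    simp only [hwdef, map_smul, real_inner_smul_left, real_inner_smul_right]
    rw [inv_mul_le_iff₀ (hd k), inv_mul_le_iff₀ (hd k)]
    linarith [hlt k]
  obtain ⟨x, φ, hφ, hx, hx0, hneg⟩ := hA.exists_weak_limit_nonpos hw hc hwc
  refine absurd (hpos x hx0 (mul_ae_eq_zero_of_inner_lpRestrict fun S hS => ?_)) hneg.not_gt
  have hbd : ∀ k, |⟪w k, lpRestrict S hS u⟫| ≤ c k + c k := by
    intro k
    rw [hwdef, real_inner_smul_left, abs_mul, abs_of_pos (inv_pos.2 (hd k)),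
      inv_mul_le_iff₀ (hd k)]
    refine (abs_inner_lpRestrict_le (h₁ k) (h₂ k) hS).trans ?_
    gcongr
    · exact (hv₁ k).le
    · exact (hv₂ k).le
  have hzero : Tendsto (fun k => ⟪w k, lpRestrict S hS u⟫) atTop (𝓝 0) :=
    squeeze_zero_norm hbd (by simpa using hc.add hc)
  exact tendsto_nhds_unique (hx _) (hzero.comp hφ.tendsto_atTop)

/-- In a nondegenerate interval every short step is a difference of two points near a given one. -/
lemma sub_mem_of_add_notMem {I : Set ℝ} (hI : I.OrdConnected) {c e r s : ℝ} (hc : c ∈ I)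
    (he : e ∈ I) (hr : r ∈ I) (hs : 2 * |s| ≤ e - c) (h : r + s ∉ I) : r - s ∈ I := by
  have hs' := abs_le.1 (le_refl |s|)
  rcases le_total 0 s with h0 | h0
  · have : e < r + s := by
      by_contra! hle
      exact h (hI.out hr he ⟨by linarith, hle⟩)
    exact hI.out hc hr ⟨by linarith, by linarith⟩
  · have : r + s < c := by
      by_contra! hle
      exact h (hI.out hc hr ⟨hle, by linarith⟩)
    exact hI.out hr he ⟨by linarith, by linarith⟩

lemma exists_feasible_pair {I : Set ℝ} (hI : I.OrdConnected) {c e : ℝ} (hc : c ∈ I) (he : e ∈ I)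
    {x u d : Lp ℝ 2 μ} (hu : u ∈ convNC (pointwiseSet μ I) x) (hud : ∀ᵐ y ∂μ, u y * d y = 0)
    (hd : ∀ᵐ y ∂μ, 2 * |d y| ≤ e - c) :
    ∃ x₁ x₂ : Lp ℝ 2 μ, x₁ - x₂ = d ∧ ‖x₁ - x‖ ≤ ‖d‖ ∧ ‖x₂ - x‖ ≤ ‖d‖ ∧
      u ∈ convNC (pointwiseSet μ I) x₁ ∧ u ∈ convNC (pointwiseSet μ I) x₂ := by
  set S : Set α := {y | x y + d y ∈ I} with hSdef
  have hS : MeasurableSet S :=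
    ((Lp.stronglyMeasurable x).measurable.add (Lp.stronglyMeasurable d).measurable)
      hI.measurableSet
  have hnc : ∀ (z : Lp ℝ 2 μ), x + z ∈ pointwiseSet μ I → ⟪u, z⟫ = 0 →
      u ∈ convNC (pointwiseSet μ I) (x + z) := by
    intro z hz huz
    refine ⟨hz, fun y hy => ?_⟩
    rw [← sub_sub, inner_sub_right, huz, sub_zero]
    exact hu.2 y hy
  have hnd : ∀ᵐ y ∂μ, u y * (-d : Lp ℝ 2 μ) y = 0 := by
    filter_upwards [hud, Lp.coeFn_neg d] with y h₁ h₂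
    rw [h₂, Pi.neg_apply, mul_neg, h₁, neg_zero]
  refine ⟨x + lpRestrict S hS d, x + lpRestrict Sᶜ hS.compl (-d), ?_, ?_, ?_, ?_, ?_⟩
  · rw [add_sub_add_left_eq_sub]
    refine Lp.ext ?_
    filter_upwards [Lp.coeFn_sub (lpRestrict S hS d) (lpRestrict Sᶜ hS.compl (-d)),
      coeFn_lpRestrict hS d, coeFn_lpRestrict hS.compl (-d), Lp.coeFn_neg d] with y h₁ h₂ h₃ h₄
    rw [h₁, Pi.sub_apply, h₂, h₃]
    by_cases hy : y ∈ S
    · simp [hy]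
    · rw [indicator_of_notMem hy, indicator_of_mem (show y ∈ Sᶜ from hy), h₄, Pi.neg_apply]
      ring
  · simpa using norm_lpRestrict_le hS d
  · simpa using norm_lpRestrict_le hS.compl (-d)
  · refine hnc _ ?_ (inner_lpRestrict_eq_zero hud hS)
    exact add_lpRestrict_mem_pointwiseSet hu.1 hS (Eventually.of_forall fun y hy => hy)
  · refine hnc _ ?_ (inner_lpRestrict_eq_zero hnd hS.compl)
    refine add_lpRestrict_mem_pointwiseSet hu.1 hS.compl ?_
    filter_upwards [hu.1, hd, Lp.coeFn_neg d] with y h₁ h₂ h₃ hy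
    rw [h₃, Pi.neg_apply, ← sub_eq_add_neg]
    exact sub_mem_of_add_notMem hI hc he h₁ h₂ hy

lemma exists_bounded_approx (w : Lp ℝ 2 μ) {ε : ℝ} (hε : 0 < ε) :
    ∃ (S : Set α) (hS : MeasurableSet S) (M : ℝ), 0 < M ∧
      (∀ᵐ y ∂μ, |lpRestrict S hS w y| ≤ M) ∧ ‖w - lpRestrict S hS w‖ ≤ ε := by
  obtain ⟨M, hM, hle⟩ :=
    (Lp.memLp w).eLpNorm_indicator_norm_ge_pos_le (Lp.stronglyMeasurable w) hε
  set T : Set α := {y | M ≤ ‖w y‖₊} with hTdef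
  have hT : MeasurableSet T :=
    measurableSet_le measurable_const (Lp.stronglyMeasurable w).measurable.nnnorm.coe_nnreal_real
  refine ⟨Tᶜ, hT.compl, M, hM, ?_, ?_⟩
  · filter_upwards [coeFn_lpRestrict hT.compl w] with y hy
    rw [hy]
    by_cases h : y ∈ T
    · simpa [h] using hM.le
    · have h' : |w y| < M := by simpa [hTdef] using h
      simpa [h] using h'.le
  · have e : w - lpRestrict Tᶜ hT.compl w = lpRestrict T hT w := by
      refine Lp.ext ?_
      filter_upwards [Lp.coeFn_sub w (lpRestrict Tᶜ hT.compl w), coeFn_lpRestrict hT w,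
        coeFn_lpRestrict hT.compl w] with y h₁ h₂ h₃
      rw [h₁, Pi.sub_apply, h₂, h₃]
      by_cases h : y ∈ T <;> simp [h]
    rw [e, lpRestrict, Lp.norm_toLp]
    exact ENNReal.toReal_le_of_le_ofReal hε.le hle

/-- Strong monotonicity of the base along feasible pairs sharing a normal forces coercivity of
its derivative on the functions supported in the zero set of that normal. -/
theorem le_inner_of_feasible_pairs {I : Set ℝ} (hI : I.OrdConnected) {c e : ℝ} (hc : c ∈ I)
    (he : e ∈ I) (hce : c < e) {F : Lp ℝ 2 μ → Lp ℝ 2 μ} {A : Lp ℝ 2 μ →L[ℝ] Lp ℝ 2 μ}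
    {x u : Lp ℝ 2 μ} {κ r : ℝ} (hr : 0 < r) (hu : u ∈ convNC (pointwiseSet μ I) x)
    (hmono : ∀ x₁ x₂, ‖x₁ - x‖ < r → ‖x₂ - x‖ < r → u ∈ convNC (pointwiseSet μ I) x₁ →
      u ∈ convNC (pointwiseSet μ I) x₂ → κ * ‖x₁ - x₂‖ ^ 2 ≤ ⟪F x₁ - F x₂, x₁ - x₂⟫)
    (hF : ∀ x₁ x₂, ‖x₁ - x‖ < r → ‖x₂ - x‖ < r →
      ‖F x₁ - F x₂ - A (x₁ - x₂)‖ ≤ κ / 2 * ‖x₁ - x₂‖)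
    {w : Lp ℝ 2 μ} (hw : ∀ᵐ y ∂μ, w y * u y = 0) : κ / 2 * ‖w‖ ^ 2 ≤ ⟪A w, w⟫ := by
  have hbdd : ∀ z : Lp ℝ 2 μ, (∀ᵐ y ∂μ, u y * z y = 0) → ∀ M : ℝ, 0 < M →
      (∀ᵐ y ∂μ, |z y| ≤ M) → κ / 2 * ‖z‖ ^ 2 ≤ ⟪A z, z⟫ := by
    intro z hz M hM hzM
    set τ : ℝ := min ((e - c) / (2 * M)) (r / (2 * (‖z‖ + 1))) with hτdef
    have hec : 0 < e - c := by linarith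
    have hτ : 0 < τ := by positivity
    have hτ1 : 2 * (τ * M) ≤ e - c := by
      have : τ ≤ (e - c) / (2 * M) := min_le_left _ _
      rw [le_div_iff₀ (by positivity)] at this
      linarith
    have hτ2 : τ * ‖z‖ < r := by
      have : τ ≤ r / (2 * (‖z‖ + 1)) := min_le_right _ _
      rw [le_div_iff₀ (by positivity)] at this
      nlinarith [norm_nonneg z]
    have hzτ : ∀ᵐ y ∂μ, u y * (τ • z : Lp ℝ 2 μ) y = 0 := by
      filter_upwards [hz, Lp.coeFn_smul τ z] with y h₁ h₂
      rw [h₂, Pi.smul_apply, smul_eq_mul, mul_left_comm, h₁, mul_zero]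
    have hzM' : ∀ᵐ y ∂μ, 2 * |(τ • z : Lp ℝ 2 μ) y| ≤ e - c := by
      filter_upwards [hzM, Lp.coeFn_smul τ z] with y h₁ h₂
      rw [h₂, Pi.smul_apply, smul_eq_mul, abs_mul, abs_of_pos hτ]
      have : τ * |z y| ≤ τ * M := by gcongr
      linarith
    obtain ⟨x₁, x₂, hd, hn₁, hn₂, hc₁, hc₂⟩ := exists_feasible_pair hI hc he hu hzτ hzM'
    rw [norm_smul, Real.norm_of_nonneg hτ.le] at hn₁ hn₂
    have m := hmono x₁ x₂ (by linarith) (by linarith) hc₁ hc₂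
    have k := hF x₁ x₂ (by linarith) (by linarith)
    rw [hd] at m k
    have i : ⟪F x₁ - F x₂ - A (τ • z), τ • z⟫ ≤ κ / 2 * ‖τ • z‖ ^ 2 := by
      refine (real_inner_le_norm _ _).trans ?_
      nlinarith [norm_nonneg (τ • z)]
    rw [inner_sub_left] at i
    have j : κ / 2 * ‖τ • z‖ ^ 2 ≤ ⟪A (τ • z), τ • z⟫ := by linarith
    rw [norm_smul, Real.norm_of_nonneg hτ.le, map_smul, real_inner_smul_left,
      real_inner_smul_right] at j
    refine le_of_mul_le_mul_left ?_ (mul_pos hτ hτ)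
    linarith
  choose S hS M hM hSM hSw using fun k : ℕ =>
    exists_bounded_approx w (Nat.one_div_pos_of_nat (α := ℝ) (n := k))
  have hlim : Tendsto (fun k => lpRestrict (S k) (hS k) w) atTop (𝓝 w) := by
    rw [tendsto_iff_norm_sub_tendsto_zero]
    refine squeeze_zero (fun _ => norm_nonneg _) (fun k => ?_)
      tendsto_one_div_add_atTop_nhds_zero_nat
    rw [norm_sub_rev]
    exact hSw k
  refine le_of_tendsto_of_tendsto' ((hlim.norm.pow 2).const_mul (κ / 2))
    (((A.continuous.tendsto w).comp hlim).inner hlim) fun k => ?_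
  refine hbdd _ ?_ (M k) (hM k) (hSM k)
  filter_upwards [hw, coeFn_lpRestrict (hS k) w] with y h₁ h₂
  rw [h₂]
  by_cases hy : y ∈ S k
  · simpa [hy, mul_comm] using h₁
  · simp [hy]

end Lp

section Box

variable {a b : EReal}

lemma isClosed_realBox (a b : EReal) : IsClosed {r : ℝ | a ≤ (r : EReal) ∧ (r : EReal) ≤ b} :=
  (isClosed_Ici.preimage continuous_coe_real_ereal).inter
    (isClosed_Iic.preimage continuous_coe_real_ereal)

lemma ordConnected_realBox (a b : EReal) :
    {r : ℝ | a ≤ (r : EReal) ∧ (r : EReal) ≤ b}.OrdConnected :=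
  ⟨fun _ hx _ hy _ hz => ⟨hx.1.trans (EReal.coe_le_coe_iff.2 hz.1),
    (EReal.coe_le_coe_iff.2 hz.2).trans hy.2⟩⟩

lemma exists_lt_mem_realBox (hab : a < b) :
    ∃ c ∈ {r : ℝ | a ≤ (r : EReal) ∧ (r : EReal) ≤ b},
      ∃ e ∈ {r : ℝ | a ≤ (r : EReal) ∧ (r : EReal) ≤ b}, c < e := by
  obtain ⟨c, hac, hcb⟩ := EReal.exists_between_coe_real hab
  obtain ⟨e, hce, heb⟩ := EReal.exists_between_coe_real hcb
  exact ⟨c, ⟨hac.le, hcb.le⟩, e, ⟨(hac.trans hce).le, heb.le⟩, EReal.coe_lt_coe_iff.1 hce⟩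

end Box

/-- characterization of full stability for PVI generated by
magnitude constraint systems in L² (Corollary 8.9). -/
theorem statement16 {n : ℕ} {P : Type*} [MetricSpace P]
    (Om : Set (EuclideanSpace ℝ (Fin n))) (hOm : IsOpen Om)
    (a b : EReal) (hab : a < b)
    (f : Lp ℝ 2 (volume.restrict Om) → P → Lp ℝ 2 (volume.restrict Om))
    (Df : Lp ℝ 2 (volume.restrict Om) → P →
      Lp ℝ 2 (volume.restrict Om) →L[ℝ] Lp ℝ 2 (volume.restrict Om))
    (C : Set (Lp ℝ 2 (volume.restrict Om)))
    (hC : C = {x | ∀ᵐ y ∂(volume.restrict Om),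
        a ≤ ((x y : ℝ) : EReal) ∧ ((x y : ℝ) : EReal) ≤ b})
    (xb vb : Lp ℝ 2 (volume.restrict Om)) (pb : P)
    (hsol : xb ∈ SolMapVI f C vb pb)
    (hA1 : A1two f xb pb) (hA4 : A4two f Df xb pb)
    (hLeg : LegendreForm fun w => ⟪Df xb pb w, w⟫) :
    FullStable2 (SolMapVI f C) xb vb pb ↔
      ∀ w : Lp ℝ 2 (volume.restrict Om), w ≠ 0 →
        (∀ᵐ y ∂(volume.restrict Om), w y * (vb - f xb pb) y = 0) →
        0 < ⟪Df xb pb w, w⟫ := by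
  set I : Set ℝ := {r : ℝ | a ≤ (r : EReal) ∧ (r : EReal) ≤ b} with hIdef
  have hI : I.OrdConnected := ordConnected_realBox a b
  obtain rfl : C = pointwiseSet (volume.restrict Om) I := hC
  constructor
  · intro hstab w hw0 hw
    obtain ⟨c, hc, e, he, hce⟩ := exists_lt_mem_realBox hab
    obtain ⟨κ, hκ, ε, hε, hmono⟩ := hstab.exists_inner_le hA1.continuousAt
    obtain ⟨r, hr, hF⟩ := hA4.strict_estimate (half_pos hκ)
    have h := le_inner_of_feasible_pairs hI hc he hce (F := fun x => f x pb) (lt_min hε hr) hsol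
      (fun x₁ x₂ h₁ h₂ => hmono x₁ x₂ (h₁.trans_le (min_le_left _ _))
        (h₂.trans_le (min_le_left _ _)))
      (fun x₁ x₂ h₁ h₂ => hF x₁ x₂ pb (h₁.trans_le (min_le_right _ _))
        (h₂.trans_le (min_le_right _ _)) (by simpa)) hw
    have := norm_pos_iff.2 hw0
    exact lt_of_lt_of_le (by positivity) h
  · intro hpos
    have : Fact ((2 : ENNReal) ≠ ⊤) := ⟨ENNReal.ofNat_ne_top⟩
    obtain ⟨ε, hε, hcoer⟩ := exists_coercive_of_legendreForm (I := I) hLeg hpos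
    exact fullStable2_of_coercive (isClosed_pointwiseSet (isClosed_realBox a b))
      (convex_pointwiseSet hI.convex) hsol hA1 hA4 hε hcoer

end PVS
end
end
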